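/- Let G be an even-hole-free graph, and let a ∈ V(G) be splendid. Suppose there is no extended near-prism contained in G such that a is an end of its cross-edge. Let 𝒮=(a,S1,…,Sk) be an indecomposable pyramid strip system with apex a, with strips Si=(Ai,Bi,Ci) for 1≤i≤k, chosen with V(𝒮) maximal. Then for each component F of G\(V(𝒮)∪N[a]), either 𝒮(F) is a nonempty subset of B1∪…∪Bk, or for some i∈{1,…,k}, 𝒮(F) is a subset of V(Si) and has nonempty intersection with Bi∪Ci. -/

import Mathlib

open SimpleGraph

namespace EHF

variable {V : Type*} {W : Type*} {U : Type*}

/-- The closed neighbourhood `N[a]` of a vertex `a`. -/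
def closedNbhd (G : SimpleGraph V) (a : V) : Set V := insert a (G.neighborSet a)

/-- A hole: an induced cycle of length at least four. -/
def IsHole (G : SimpleGraph V) {v : V} (c : G.Walk v v) : Prop :=
  c.IsCycle ∧ 4 ≤ c.length ∧
    ∀ x y : V, x ∈ c.support → y ∈ c.support → G.Adj x y → s(x, y) ∈ c.edges

/-- A graph is even-hole-free if it has no hole with an even number of vertices. -/
def EvenHoleFree (G : SimpleGraph V) : Prop :=
  ∀ (v : V) (c : G.Walk v v), IsHole G c → ¬ Even c.length

/-- A vertex is bisimplicial if its neighbourhood is the union of two cliques. -/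
def Bisimplicial (G : SimpleGraph V) (v : V) : Prop :=
  ∃ K₁ K₂ : Set V, G.IsClique K₁ ∧ G.IsClique K₂ ∧ G.neighborSet v = K₁ ∪ K₂

/-- `F` induces a connected subgraph of `G`. -/
def ConnectedSubset (G : SimpleGraph V) (F : Set V) : Prop :=
  F.Nonempty ∧ ∀ x ∈ F, ∀ y ∈ F, ∃ p : G.Walk x y, ∀ z ∈ p.support, z ∈ F

/-- `F` is the vertex set of a connected component of `G` minus the vertex set `S`. -/
def IsComponentOf (G : SimpleGraph V) (S F : Set V) : Prop :=
  ConnectedSubset G F ∧ Disjoint F S ∧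
    ∀ x ∈ F, ∀ y : V, y ∉ S → G.Adj x y → y ∈ F

/-- The set of vertices of `S` having a neighbour in `F`. -/
def Att (G : SimpleGraph V) (S F : Set V) : Set V :=
  {v ∈ S | ∃ x ∈ F, G.Adj v x}

/-- A cutset: the rest of the graph is the union of two nonempty sets that are
anticomplete to each other. -/
def IsCutset (G : SimpleGraph V) (C : Set V) : Prop :=
  ∃ X Y : Set V, X.Nonempty ∧ Y.Nonempty ∧ Disjoint X Y ∧ X ∪ Y = Cᶜ ∧
    ∀ x ∈ X, ∀ y ∈ Y, ¬ G.Adj x y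

/-- `G` has a full star cutset with centre `v`. -/
def FullStarCutset (G : SimpleGraph V) (v : V) : Prop :=
  IsCutset G (closedNbhd G v)

/-- A walk is induced if every edge of `G` between vertices of the walk is an
edge of the walk. -/
def InducedWalk (G : SimpleGraph V) {x y : V} (P : G.Walk x y) : Prop :=
  ∀ u v : V, u ∈ P.support → v ∈ P.support → G.Adj u v → s(u, v) ∈ P.edges

/-- A theta with ends `u,w` and constituent paths `P₁,P₂,P₃`, as an induced
subgraph of `G`. -/
def IsThetaIn (G : SimpleGraph V) (u w : V) (P₁ P₂ P₃ : G.Walk u w) : Prop :=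
  u ≠ w ∧ P₁.IsPath ∧ P₂.IsPath ∧ P₃.IsPath ∧
  2 ≤ P₁.length ∧ 2 ≤ P₂.length ∧ 2 ≤ P₃.length ∧
  (∀ v : V, v ∈ P₁.support → v ∈ P₂.support → v = u ∨ v = w) ∧
  (∀ v : V, v ∈ P₁.support → v ∈ P₃.support → v = u ∨ v = w) ∧
  (∀ v : V, v ∈ P₂.support → v ∈ P₃.support → v = u ∨ v = w) ∧
  (∀ x y : V, (x ∈ P₁.support ∨ x ∈ P₂.support ∨ x ∈ P₃.support) →
    (y ∈ P₁.support ∨ y ∈ P₂.support ∨ y ∈ P₃.support) → G.Adj x y →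
    s(x, y) ∈ P₁.edges ∨ s(x, y) ∈ P₂.edges ∨ s(x, y) ∈ P₃.edges)

/-- A near-prism with bases `{a₁,a₂,a₃}`, `{b₁,b₂,b₃}` and constituent paths
`R₁,R₂,R₃`, as an induced subgraph of `G`. -/
def IsNearPrismIn (G : SimpleGraph V) (a₁ a₂ a₃ b₁ b₂ b₃ : V)
    (R₁ : G.Walk a₁ b₁) (R₂ : G.Walk a₂ b₂) (R₃ : G.Walk a₃ b₃) : Prop :=
  G.Adj a₁ a₂ ∧ G.Adj a₁ a₃ ∧ G.Adj a₂ a₃ ∧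
  G.Adj b₁ b₂ ∧ G.Adj b₁ b₃ ∧ G.Adj b₂ b₃ ∧
  (({a₁, a₂, a₃} : Set V) ∩ ({b₁, b₂, b₃} : Set V) = ({a₃} : Set V) ∩ ({b₃} : Set V)) ∧
  R₁.IsPath ∧ R₂.IsPath ∧ R₃.IsPath ∧
  (∀ v : V, v ∈ R₁.support → v ∉ R₂.support) ∧
  (∀ v : V, v ∈ R₁.support → v ∉ R₃.support) ∧
  (∀ v : V, v ∈ R₂.support → v ∉ R₃.support) ∧
  (∀ p q : V, (p ∈ R₁.support ∨ p ∈ R₂.support ∨ p ∈ R₃.support) →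
    (q ∈ R₁.support ∨ q ∈ R₂.support ∨ q ∈ R₃.support) → G.Adj p q →
    s(p, q) ∈ R₁.edges ∨ s(p, q) ∈ R₂.edges ∨ s(p, q) ∈ R₃.edges ∨
    s(p, q) = s(a₁, a₂) ∨ s(p, q) = s(a₁, a₃) ∨ s(p, q) = s(a₂, a₃) ∨
    s(p, q) = s(b₁, b₂) ∨ s(p, q) = s(b₁, b₃) ∨ s(p, q) = s(b₂, b₃))

/-- An extended near-prism contained in `G`, with cross-edge `xy` where
`x` lies in the interior of `R₁` and `y` in the interior of `R₂`. -/
def IsExtNearPrismIn (G : SimpleGraph V) (a₁ a₂ a₃ b₁ b₂ b₃ : V)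
    (R₁ : G.Walk a₁ b₁) (R₂ : G.Walk a₂ b₂) (R₃ : G.Walk a₃ b₃) (x y : V) : Prop :=
  G.Adj a₁ a₂ ∧ G.Adj a₁ a₃ ∧ G.Adj a₂ a₃ ∧
  G.Adj b₁ b₂ ∧ G.Adj b₁ b₃ ∧ G.Adj b₂ b₃ ∧
  (({a₁, a₂, a₃} : Set V) ∩ ({b₁, b₂, b₃} : Set V) = ({a₃} : Set V) ∩ ({b₃} : Set V)) ∧
  R₁.IsPath ∧ R₂.IsPath ∧ R₃.IsPath ∧
  (∀ v : V, v ∈ R₁.support → v ∉ R₂.support) ∧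
  (∀ v : V, v ∈ R₁.support → v ∉ R₃.support) ∧
  (∀ v : V, v ∈ R₂.support → v ∉ R₃.support) ∧
  x ∈ R₁.support ∧ x ≠ a₁ ∧ x ≠ b₁ ∧
  y ∈ R₂.support ∧ y ≠ a₂ ∧ y ≠ b₂ ∧
  G.Adj x y ∧
  (∀ p q : V, (p ∈ R₁.support ∨ p ∈ R₂.support ∨ p ∈ R₃.support) →
    (q ∈ R₁.support ∨ q ∈ R₂.support ∨ q ∈ R₃.support) → G.Adj p q →
    s(p, q) ∈ R₁.edges ∨ s(p, q) ∈ R₂.edges ∨ s(p, q) ∈ R₃.edges ∨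
    s(p, q) = s(a₁, a₂) ∨ s(p, q) = s(a₁, a₃) ∨ s(p, q) = s(a₂, a₃) ∨
    s(p, q) = s(b₁, b₂) ∨ s(p, q) = s(b₁, b₃) ∨ s(p, q) = s(b₂, b₃) ∨
    s(p, q) = s(x, y))

/-- There is an extended near-prism contained in `G` such that `a` is an end of
its cross-edge. -/
def ExtNearPrismCrossEnd (G : SimpleGraph V) (a : V) : Prop :=
  ∃ (a₁ a₂ a₃ b₁ b₂ b₃ : V) (R₁ : G.Walk a₁ b₁) (R₂ : G.Walk a₂ b₂)
    (R₃ : G.Walk a₃ b₃) (y : V),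
    IsExtNearPrismIn G a₁ a₂ a₃ b₁ b₂ b₃ R₁ R₂ R₃ a y ∨
    IsExtNearPrismIn G a₁ a₂ a₃ b₁ b₂ b₃ R₁ R₂ R₃ y a

/-- `G` contains an even wheel (as an induced subgraph). -/
def HasEvenWheel (G : SimpleGraph V) : Prop :=
  ∃ (u : V) (c : G.Walk u u) (v : V), IsHole G c ∧ v ∉ c.support ∧
    3 ≤ {x : V | x ∈ c.support ∧ G.Adj v x}.ncard ∧
    ({x : V | x ∈ c.support ∧ G.Adj v x}.ncard = 3 →
      ∀ x y : V, x ∈ c.support → y ∈ c.support → G.Adj v x → G.Adj v y → ¬ G.Adj x y) ∧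
    Even {x : V | x ∈ c.support ∧ G.Adj v x}.ncard

/-- A pyramid with apex `a`, base `{b₁,b₂,b₃}` and constituent paths
`R₁,R₂,R₃`, as an induced subgraph of `G`. -/
def IsPyramidIn (G : SimpleGraph V) (a b₁ b₂ b₃ : V)
    (R₁ : G.Walk a b₁) (R₂ : G.Walk a b₂) (R₃ : G.Walk a b₃) : Prop :=
  G.Adj b₁ b₂ ∧ G.Adj b₁ b₃ ∧ G.Adj b₂ b₃ ∧
  a ≠ b₁ ∧ a ≠ b₂ ∧ a ≠ b₃ ∧
  R₁.IsPath ∧ R₂.IsPath ∧ R₃.IsPath ∧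
  (∀ v : V, v ∈ R₁.support → v ∈ R₂.support → v = a) ∧
  (∀ v : V, v ∈ R₁.support → v ∈ R₃.support → v = a) ∧
  (∀ v : V, v ∈ R₂.support → v ∈ R₃.support → v = a) ∧
  ((2 ≤ R₁.length ∧ 2 ≤ R₂.length) ∨ (2 ≤ R₁.length ∧ 2 ≤ R₃.length) ∨
    (2 ≤ R₂.length ∧ 2 ≤ R₃.length)) ∧
  (∀ p q : V, (p ∈ R₁.support ∨ p ∈ R₂.support ∨ p ∈ R₃.support) →
    (q ∈ R₁.support ∨ q ∈ R₂.support ∨ q ∈ R₃.support) → G.Adj p q →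
    s(p, q) ∈ R₁.edges ∨ s(p, q) ∈ R₂.edges ∨ s(p, q) ∈ R₃.edges ∨
    s(p, q) = s(b₁, b₂) ∨ s(p, q) = s(b₁, b₃) ∨ s(p, q) = s(b₂, b₃))

/-- A vertex `a` is splendid: `V(G)\N[a]` is connected, every neighbour of `a`
has a neighbour in `V(G)\N[a]`, and there is no short pyramid with apex `a`. -/
def Splendid (G : SimpleGraph V) (a : V) : Prop :=
  ConnectedSubset G ((closedNbhd G a)ᶜ) ∧
  (∀ v : V, G.Adj a v → ∃ w : V, w ∉ closedNbhd G a ∧ G.Adj v w) ∧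
  ¬ ∃ (b₁ b₂ b₃ : V) (R₁ : G.Walk a b₁) (R₂ : G.Walk a b₂) (R₃ : G.Walk a b₃),
      IsPyramidIn G a b₁ b₂ b₃ R₁ R₂ R₃ ∧
      (R₁.length = 1 ∨ R₂.length = 1 ∨ R₃.length = 1)

/-- A rung of the strip `(A,B,C)`. -/
def IsRung (G : SimpleGraph V) (A B C : Set V) {x y : V} (P : G.Walk x y) : Prop :=
  P.IsPath ∧ x ∈ A ∧ y ∈ B ∧
  (∀ v ∈ P.support, v ≠ x → v ≠ y → v ∈ C) ∧
  (x ≠ y → x ∉ B ∧ y ∉ A) ∧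
  InducedWalk G P

/-- A strip `(A,B,C)`: `A,B` nonempty and disjoint from `C`, and every vertex of
`A∪B∪C` lies on a rung. -/
def IsStrip (G : SimpleGraph V) (A B C : Set V) : Prop :=
  A.Nonempty ∧ B.Nonempty ∧ Disjoint A C ∧ Disjoint B C ∧
  ∀ v ∈ A ∪ B ∪ C, ∃ (x y : V) (P : G.Walk x y), IsRung G A B C P ∧ v ∈ P.support

/-- A `J`-strip system in `G`. -/
structure StripSystem (G : SimpleGraph V) (J : SimpleGraph W) where
  ME : W → W → Set V
  MV : W → Set V
  me_symm : ∀ u v : W, ME u v = ME v u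
  me_disj : ∀ u v w x : W, J.Adj u v → J.Adj w x → s(u, v) ≠ s(w, x) →
    Disjoint (ME u v) (ME w x)
  mv_sub : ∀ u : W, MV u ⊆ ⋃ (v : W), ⋃ (_ : J.Adj u v), ME u v
  strip : ∀ u v : W, J.Adj u v →
    IsStrip G (ME u v ∩ MV u) (ME u v ∩ MV v) (ME u v \ (MV u ∪ MV v))
  far : ∀ u v w x : W, J.Adj u v → J.Adj w x → u ≠ w → u ≠ x → v ≠ w → v ≠ x →
    ∀ p ∈ ME u v, ∀ q ∈ ME w x, ¬ G.Adj p q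
  near : ∀ u v w : W, J.Adj u v → J.Adj u w → v ≠ w →
    ∀ p ∈ ME u v, ∀ q ∈ ME u w, (G.Adj p q ↔ p ∈ MV u ∧ q ∈ MV u)

/-- `V(M)`: the union of the sets `M_e` over the edges of `J`. -/
def VM {G : SimpleGraph V} {J : SimpleGraph W} (S : StripSystem G J) : Set V :=
  ⋃ (u : W), ⋃ (v : W), ⋃ (_ : J.Adj u v), S.ME u v

/-- A leaf of a graph: a vertex of degree exactly one. -/
def IsLeaf (J : SimpleGraph W) (u : W) : Prop := (J.neighborSet u).ncard = 1

/-- `ab` is a cross-edge for the strip system `S` with partition `(α,β)` of the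
leaves of `J`. -/
def IsCrossEdge {G : SimpleGraph V} {J : SimpleGraph W} (S : StripSystem G J)
    (a b : V) (α β : Set W) : Prop :=
  G.Adj a b ∧
  α ∪ β = {u : W | IsLeaf J u} ∧ Disjoint α β ∧
  (∀ u : W, (J.neighborSet u).ncard ≠ 2) ∧
  3 ≤ Nat.card W ∧
  (∀ u u₁ u₂ : W, u₁ ∈ α → u₂ ∈ α → J.Adj u u₁ → J.Adj u u₂ → u₁ = u₂) ∧
  (∀ u u₁ u₂ : W, u₁ ∈ β → u₂ ∈ β → J.Adj u u₁ → J.Adj u u₂ → u₁ = u₂) ∧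
  (∀ u v : W, J.Adj u v → a ∉ S.ME u v ∧ b ∉ S.ME u v) ∧
  (∀ x ∈ VM S, (G.Adj a x ↔ ∃ u ∈ α, x ∈ S.MV u)) ∧
  (∀ x ∈ VM S, (G.Adj b x ↔ ∃ u ∈ β, x ∈ S.MV u))

/-- A local subset of `V(M)∪{a,b}`. -/
def IsLocal {G : SimpleGraph V} {J : SimpleGraph W} (S : StripSystem G J)
    (a b : V) (α β : Set W) (X : Set V) : Prop :=
  (∃ u v : W, J.Adj u v ∧ X ⊆ S.ME u v) ∨
  (∃ u : W, X ⊆ S.MV u) ∨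
  (a ∈ X ∧ b ∉ X ∧ ∃ u ∈ α, X \ {a} ⊆ S.MV u) ∨
  (b ∈ X ∧ a ∉ X ∧ ∃ u ∈ β, X \ {b} ⊆ S.MV u)

/-- A branch-vertex of a tree: a vertex of degree different from two. -/
def BranchVertex (T : SimpleGraph U) (u : U) : Prop := (T.neighborSet u).ncard ≠ 2

/-- `u` and `v` are distinct branch-vertices joined by a branch of `T`. -/
def JoinedByBranch (T : SimpleGraph U) (u v : U) : Prop :=
  u ≠ v ∧ BranchVertex T u ∧ BranchVertex T v ∧
    ∃ p : T.Walk u v, p.IsPath ∧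
      ∀ w ∈ p.support, w ≠ u → w ≠ v → (T.neighborSet w).ncard = 2

/-- The shape of a tree `T`: the graph on its branch-vertices, two being
adjacent when joined by a branch. -/
def Shape (T : SimpleGraph U) : SimpleGraph {u : U // BranchVertex T u} :=
  SimpleGraph.fromRel (fun u v => JoinedByBranch T u.1 v.1)

/-- `y` is reachable from `x` in `T` by a walk avoiding `v`. -/
def ReachAvoiding (T : SimpleGraph U) (v x y : U) : Prop :=
  ∃ p : T.Walk x y, v ∉ p.support

/-- The component of `x` in `T` minus `v` contains no vertex of `A`. -/
def MissesSet (T : SimpleGraph U) (v : U) (A : Set U) (x : U) : Prop :=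
  ∀ z : U, ReachAvoiding T v x z → z ∉ A

/-- `G` contains an induced extended tree line-graph `H(T)` with cross-edge
`ab`, via the injection `φ` of the edges of `T` into `V(G)`, where `(A',B')`
is the bipartition of the tree `T`. -/
def ExtTreeLineGraphIn (G : SimpleGraph V) (T : SimpleGraph U)
    (A' B' : Set U) (a b : V) (φ : Sym2 U → V) : Prop :=
  T.IsTree ∧
  A' ∪ B' = Set.univ ∧ Disjoint A' B' ∧
  (∀ u v : U, T.Adj u v → (u ∈ A' ↔ v ∈ B')) ∧
  3 ≤ {u : U | IsLeaf T u}.ncard ∧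
  (∀ v x y : U, x ≠ v → y ≠ v → MissesSet T v A' x → MissesSet T v A' y →
    ReachAvoiding T v x y) ∧
  (∀ v x y : U, x ≠ v → y ≠ v → MissesSet T v B' x → MissesSet T v B' y →
    ReachAvoiding T v x y) ∧
  G.Adj a b ∧
  Set.InjOn φ T.edgeSet ∧
  (∀ e ∈ T.edgeSet, φ e ≠ a ∧ φ e ≠ b) ∧
  (∀ e ∈ T.edgeSet, ∀ f ∈ T.edgeSet, e ≠ f →
    (G.Adj (φ e) (φ f) ↔ ∃ u : U, u ∈ e ∧ u ∈ f)) ∧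
  (∀ e ∈ T.edgeSet, (G.Adj a (φ e) ↔ ∃ u : U, u ∈ e ∧ IsLeaf T u ∧ u ∈ A')) ∧
  (∀ e ∈ T.edgeSet, (G.Adj b (φ e) ↔ ∃ u : U, u ∈ e ∧ IsLeaf T u ∧ u ∈ B'))

/-- `(J, M)` is optimal for the edge `ab`: `G` contains an induced extended tree
line-graph with cross-edge `ab`; among all such, the shape `J` has as many edges
as possible; and the `J`-strip system `S` has cross-edge `ab` with partition
`(α,β)` and `V(M)` maximal. -/
def OptimalFor {G : SimpleGraph V} {J : SimpleGraph W} (S : StripSystem G J)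
    (a b : V) (α β : Set W) : Prop :=
  (∃ (n : ℕ) (T : SimpleGraph (Fin n)) (A' B' : Set (Fin n)) (φ : Sym2 (Fin n) → V),
      ExtTreeLineGraphIn G T A' B' a b φ ∧ Nonempty (J ≃g Shape T)) ∧
  (∀ (n : ℕ) (T : SimpleGraph (Fin n)) (A' B' : Set (Fin n)) (φ : Sym2 (Fin n) → V),
      ExtTreeLineGraphIn G T A' B' a b φ →
      (Shape T).edgeSet.ncard ≤ J.edgeSet.ncard) ∧
  IsCrossEdge S a b α β ∧
  (∀ (S' : StripSystem G J) (α' β' : Set W), IsCrossEdge S' a b α' β' →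
      VM S ⊆ VM S' → VM S' = VM S)

/-- There is a path from `y` to `VMset \ N[a]` containing no neighbours of `a`
except `y`. -/
def ExternalFrom (G : SimpleGraph V) (VMset : Set V) (a y : V) : Prop :=
  ∃ (z : V) (P : G.Walk y z), P.IsPath ∧ z ∈ VMset ∧ z ∉ closedNbhd G a ∧
    ∀ v ∈ P.support, G.Adj a v → v = y

/-- A major vertex: a common neighbour of `a,b` that is both `a`-external and
`b`-external. -/
def MajorVertex {G : SimpleGraph V} {J : SimpleGraph W} (S : StripSystem G J)
    (a b : V) (y : V) : Prop :=
  G.Adj a y ∧ G.Adj b y ∧ ExternalFrom G (VM S) a y ∧ ExternalFrom G (VM S) b y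

/-- The vertex set of a pyramid strip system. -/
def PSSVerts (a : V) {k : ℕ} (A B C : Fin k → Set V) : Set V :=
  insert a (⋃ i, A i ∪ B i ∪ C i)

/-- A pyramid strip system with apex `a` and proper strips `(A i, B i, C i)`. -/
def IsPyramidStripSystem (G : SimpleGraph V) (a : V) {k : ℕ}
    (A B C : Fin k → Set V) : Prop :=
  3 ≤ k ∧
  (∀ i, IsStrip G (A i) (B i) (C i)) ∧
  (∀ i, Disjoint (A i) (B i)) ∧
  (∀ i j, i ≠ j → Disjoint (A i ∪ B i ∪ C i) (A j ∪ B j ∪ C j)) ∧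
  (∀ i j, i ≠ j → ∀ p ∈ A i ∪ B i ∪ C i, ∀ q ∈ A j ∪ B j ∪ C j,
      (G.Adj p q ↔ p ∈ B i ∧ q ∈ B j)) ∧
  (∀ i, a ∉ A i ∪ B i ∪ C i) ∧
  (∀ i, ∀ p ∈ A i ∪ B i ∪ C i, (G.Adj a p ↔ p ∈ A i))

/-- `D i`: the union of the vertex sets of all components `F` of
`G \ (V(𝒮) ∪ N[a])` having a neighbour in `A i ∪ C i`. -/
def PSSD (G : SimpleGraph V) (a : V) {k : ℕ} (A B C : Fin k → Set V)
    (i : Fin k) : Set V :=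
  ⋃₀ {F : Set V | IsComponentOf G (PSSVerts a A B C ∪ closedNbhd G a) F ∧
      ∃ v ∈ A i ∪ C i, ∃ x ∈ F, G.Adj v x}

def TypeAlpha (G : SimpleGraph V) {k : ℕ} (A B C : Fin k → Set V) (v : V) : Prop :=
  ∀ i : Fin k, (∃ p ∈ B i ∪ C i, G.Adj v p) ∨ ∀ p ∈ A i, G.Adj v p

def TypeAlpha' (G : SimpleGraph V) (a : V) {k : ℕ} (A B C : Fin k → Set V)
    (v : V) : Prop :=
  ∃ i : Fin k, (∃ x ∈ PSSD G a A B C i, G.Adj v x) ∧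
    (∀ p ∈ B i ∪ C i, ¬ G.Adj v p) ∧
    ∀ j : Fin k, j ≠ i →
      (∀ p ∈ A j, G.Adj v p) ∧ ∀ p ∈ B j ∪ C j ∪ PSSD G a A B C j, ¬ G.Adj v p

def TypeBeta (G : SimpleGraph V) {k : ℕ} (A B C : Fin k → Set V) (v : V) : Prop :=
  ∃ i : Fin k, (∀ p ∈ A i ∪ B i ∪ C i, ¬ G.Adj v p) ∧
    ∀ j : Fin k, j ≠ i → ∃ p ∈ B j ∪ C j, G.Adj v p

def TypeGamma (G : SimpleGraph V) (a : V) {k : ℕ} (A B C : Fin k → Set V)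
    (v : V) : Prop :=
  ∃ (i : Fin k) (q : V) (Q : G.Walk v q), Q.IsPath ∧ InducedWalk G Q ∧
    (∀ w ∈ Q.support, w ≠ v → w ∉ PSSVerts a A B C ∪ closedNbhd G a) ∧
    (∃ p ∈ ⋃ j, B j, G.Adj q p) ∧
    ((∀ p ∈ (⋃ j, B j) \ B i, G.Adj q p) ∨ ∀ p ∈ (⋃ j, B j) \ B i, ¬ G.Adj q p) ∧
    (∀ j : Fin k, j ≠ i → ∀ p ∈ A j, G.Adj v p) ∧
    (∀ j : Fin k, ∀ p ∈ B j ∪ C j ∪ PSSD G a A B C j, ¬ G.Adj v p) ∧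
    ∀ w ∈ Q.support, w ≠ v → ∀ p ∈ PSSVerts a A B C, G.Adj w p →
      w = q ∧ p ∈ ⋃ j, B j

/-- A backdoor for `z`, relative to the strip `(A,B,C)` and the set `D`. -/
def Backdoor (G : SimpleGraph V) (A B C D : Set V) (z : V) : Prop :=
  ∃ (b' : V) (R : G.Walk z b'), R.IsPath ∧ InducedWalk G R ∧
    (∀ w ∈ R.support, w ≠ z → w ≠ b' → ∀ p ∈ (A ∪ B ∪ C) ∪ D, ¬ G.Adj w p) ∧
    (∀ p ∈ B, G.Adj b' p) ∧ ∀ p ∈ A ∪ C ∪ D, ¬ G.Adj b' p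

/-- The list `l` is the vertex sequence of an induced path of `G`. -/
def IndPath (G : SimpleGraph V) : List V → Prop
  | [] => True
  | u :: l => IndPath G l ∧ ∀ v ∈ l, u ≠ v ∧ (G.Adj u v ↔ l.head? = some v)

theorem indPath_cons {G : SimpleGraph V} {u : V} {l : List V} :
    IndPath G (u :: l) ↔
      IndPath G l ∧ ∀ v ∈ l, u ≠ v ∧ (G.Adj u v ↔ l.head? = some v) := Iff.rfl

theorem indPath_singleton {G : SimpleGraph V} {u : V} : IndPath G [u] := by
  simp [IndPath]

theorem indPath_append {G : SimpleGraph V} {l m : List V} :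
    IndPath G (l ++ m) ↔ IndPath G l ∧ IndPath G m ∧
      ∀ x ∈ l, ∀ y ∈ m, x ≠ y ∧ (G.Adj x y ↔ l.getLast? = some x ∧ m.head? = some y) := by
  induction l with
  | nil => simp [IndPath]
  | cons u l ih =>
    rw [List.cons_append, indPath_cons, indPath_cons, ih]
    cases l with
    | nil =>
      simp [IndPath]
    | cons v l =>
      constructor
      · rintro ⟨⟨h1, h2, h3⟩, h4⟩
        refine ⟨⟨h1, fun z hz => ?_⟩, h2, fun x hx y hy => ?_⟩
        · simpa using h4 z (List.mem_append_left _ hz)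
        · have hvy := (h3 v (by simp) y hy).1
          have hu := h4 v (by simp)
          rcases List.mem_cons.1 hx with rfl | hx
          · have := h4 y (List.mem_append_right _ hy)
            refine ⟨this.1, ?_⟩
            rw [this.2]
            constructor
            · intro h; simp at h; exact absurd h hvy
            · rintro ⟨h, -⟩
              have hm : x ∈ v :: l := by
                rw [List.getLast?_cons_cons] at h
                exact List.mem_of_getLast? h
              exact absurd rfl (h4 x (List.mem_append_left _ hm)).1
          · rw [List.getLast?_cons_cons]
            exact h3 x hx y hy
      · rintro ⟨⟨h1, h2⟩, h3, h4⟩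
        refine ⟨⟨h1, h3, fun x hx y hy => ?_⟩, fun z hz => ?_⟩
        · have := h4 x (List.mem_cons_of_mem _ hx) y hy
          rwa [List.getLast?_cons_cons] at this
        · rcases List.mem_append.1 hz with hz | hz
          · simpa using h2 z hz
          · have := h4 u (by simp) z hz
            refine ⟨this.1, ?_⟩
            rw [this.2, List.getLast?_cons_cons]
            constructor
            · rintro ⟨h, -⟩
              exact absurd rfl (h2 u (List.mem_of_getLast? h)).1
            · intro h
              simp at h
              exact absurd h (h4 v (by simp) z hz).1

theorem IndPath.reverse {G : SimpleGraph V} {l : List V} (h : IndPath G l) :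
    IndPath G l.reverse := by
  induction l with
  | nil => simpa
  | cons u l ih =>
    rw [List.reverse_cons, indPath_append]
    refine ⟨ih h.1, indPath_singleton, fun x hx y hy => ?_⟩
    obtain rfl : y = u := by simpa using hy
    have := h.2 x (by simpa using hx)
    refine ⟨this.1.symm, ?_⟩
    rw [G.adj_comm, this.2]
    simp

theorem IndPath.nodup {G : SimpleGraph V} {l : List V} (h : IndPath G l) : l.Nodup := by
  induction l with
  | nil => simp
  | cons u l ih =>
    rw [List.nodup_cons]
    exact ⟨fun hu => (h.2 u hu).1 rfl, ih h.1⟩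

theorem IndPath.exists_walk {G : SimpleGraph V} {l : List V} {u v : V} (h : IndPath G l)
    (hu : l.head? = some u) (hv : l.getLast? = some v) :
    ∃ w : G.Walk u v, w.support = l ∧ w.IsPath ∧ InducedWalk G w := by
  induction l generalizing u with
  | nil => simp at hu
  | cons x l ih =>
    obtain rfl : x = u := by simpa using hu
    cases l with
    | nil =>
      obtain rfl : x = v := by simpa using hv
      refine ⟨Walk.nil, by simp, by simp, ?_⟩
      intro p q hp hq hpq
      simp only [Walk.support_nil, List.mem_singleton] at hp hq
      subst hp hq
      exact absurd hpq G.irrefl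
    | cons y l =>
      obtain ⟨w, hw, hwp, hwi⟩ := ih (u := y) h.1 rfl (by rwa [List.getLast?_cons_cons] at hv)
      have hxy : G.Adj x y := (h.2 y (by simp)).2.2 rfl
      refine ⟨Walk.cons hxy w, by simp [hw], ?_, ?_⟩
      · rw [Walk.cons_isPath_iff, hw]
        exact ⟨hwp, fun hx => (h.2 x hx).1 rfl⟩
      · have key : ∀ q ∈ w.support, G.Adj x q → y = q := by
          intro q hq hxq
          rw [hw] at hq
          simpa using (h.2 q hq).2.1 hxq
        intro p q hp hq hpq
        rw [Walk.support_cons, List.mem_cons] at hp hq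
        rw [Walk.edges_cons, List.mem_cons]
        rcases hp with rfl | hp <;> rcases hq with rfl | hq
        · exact absurd hpq G.irrefl
        · left; rw [key q hq hpq]
        · left; rw [key p hp hpq.symm, Sym2.eq_swap]
        · exact Or.inr (hwi p q hp hq hpq)

theorem indPath_support {G : SimpleGraph V} {u v : V} {w : G.Walk u v} (hp : w.IsPath)
    (hi : InducedWalk G w) : IndPath G w.support := by
  induction w with
  | nil => simpa using indPath_singleton
  | @cons x y z hxy w ih =>
    rw [Walk.cons_isPath_iff] at hp
    have hne : ∀ q ∈ w.support, x ≠ q := fun q hq h => hp.2 (h ▸ hq)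
    rw [Walk.support_cons, indPath_cons]
    refine ⟨ih hp.1 ?_, fun q hq => ⟨hne q hq, ?_⟩⟩
    · intro p q hp' hq hpq
      have := hi p q (by simp [hp']) (by simp [hq]) hpq
      rw [Walk.edges_cons, List.mem_cons] at this
      rcases this with h | h
      · rw [Sym2.eq_iff] at h
        rcases h with ⟨h, -⟩ | ⟨-, h⟩
        · exact absurd h.symm (hne p hp')
        · exact absurd h.symm (hne q hq)
      · exact h
    · rw [← Walk.cons_tail_support w, List.head?_cons, Option.some_inj]
      constructor
      · intro hxq
        have := hi x q (by simp) (by simp [hq]) hxq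
        rw [Walk.edges_cons, List.mem_cons] at this
        rcases this with h | h
        · rw [Sym2.eq_iff] at h
          rcases h with ⟨-, h⟩ | ⟨h, h'⟩
          · exact h.symm
          · exact absurd h'.symm (hne q hq)
        · exact absurd (w.fst_mem_support_of_mem_edges h) hp.2
      · rintro rfl
        exact hxy

/-- A chordless closed vertex sequence `v :: l` of length at least three is odd. -/
theorem EvenHoleFree.even_length {G : SimpleGraph V} (hG : EvenHoleFree G) {v : V} {l : List V}
    (h : IndPath G l) (hl : 2 ≤ l.length) (hv : v ∉ l)
    (hadj : ∀ x ∈ l, G.Adj v x ↔ l.head? = some x ∨ l.getLast? = some x) : Even l.length := by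
  rcases hl.eq_or_lt with h2 | h3
  · rw [← h2]; decide
  have hne : l ≠ [] := by rintro rfl; simp at hl
  obtain ⟨x, hx⟩ : ∃ x, l.head? = some x := ⟨_, List.head?_eq_some_head hne⟩
  obtain ⟨y, hy⟩ : ∃ y, l.getLast? = some y := ⟨_, List.getLast?_eq_some_getLast hne⟩
  have hxl : x ∈ l := List.mem_of_head? hx
  have hyl : y ∈ l := List.mem_of_getLast? hy
  obtain ⟨w, hw, hwp, hwi⟩ := h.exists_walk hx hy
  have hvx : G.Adj v x := (hadj x hxl).2 (Or.inl hx)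
  have hyv : G.Adj y v := ((hadj y hyl).2 (Or.inr hy)).symm
  have hxy : x ≠ y := by
    rintro rfl
    have := Walk.nil_iff_support_eq.1 (Walk.isPath_iff_nil.1 hwp)
    rw [← hw, this] at hl
    simp at hl
  by_contra hodd
  have hlen : w.length + 1 = l.length := by rw [← hw, Walk.length_support]
  refine hG v (Walk.cons hvx (w.concat hyv)) ⟨?_, ?_, ?_⟩ ?_
  · rw [Walk.cons_isCycle_iff]
    refine ⟨hwp.concat (by rwa [hw]) hyv, ?_⟩
    rw [Walk.edges_concat, List.concat_eq_append, List.mem_append, not_or]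
    refine ⟨fun h => hv (hw ▸ w.fst_mem_support_of_mem_edges h), ?_⟩
    rw [List.mem_singleton, Sym2.eq_iff]
    rintro (⟨-, h⟩ | ⟨-, h⟩)
    · exact hvx.ne h.symm
    · exact hxy h
  · simp; omega
  · have key : ∀ q ∈ l, G.Adj v q → s(v, q) ∈ (Walk.cons hvx (w.concat hyv)).edges := by
      intro q hq hvq
      rw [Walk.edges_cons, Walk.edges_concat]
      rcases (hadj q hq).1 hvq with h | h
      · rw [hx] at h; simp at h; simp [h]
      · rw [hy] at h; simp at h; simp [h, Sym2.eq_swap]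
    intro p q hp hq hpq
    have hs : ∀ z, z ∈ (Walk.cons hvx (w.concat hyv)).support → z = v ∨ z ∈ l := by
      intro z hz
      simpa [Walk.support_concat, hw, or_comm] using hz
    rcases hs p hp with hpv | hp' <;> rcases hs q hq with hqv | hq'
    · subst hpv hqv; exact absurd hpq G.irrefl
    · subst hpv; exact key q hq' hpq
    · subst hqv; rw [Sym2.eq_swap]; exact key p hp' hpq.symm
    · have := hwi p q (hw ▸ hp') (hw ▸ hq') hpq
      simp [Walk.edges_concat, this]
  · have : (Walk.cons hvx (w.concat hyv)).length = l.length + 1 := by simp; omega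
    rw [this]
    rcases Nat.even_or_odd l.length with h | h
    · exact absurd h hodd
    · exact h.add_one

/-- Two disjoint induced paths joined in a ring form a cycle with an odd number of vertices. -/
theorem EvenHoleFree.odd_ring {G : SimpleGraph V} (hG : EvenHoleFree G) {l m : List V}
    (hl : IndPath G l) (hm : IndPath G m) (hl0 : l ≠ []) (hm0 : m ≠ [])
    (h3 : 3 ≤ l.length + m.length)
    (h : ∀ x ∈ l, ∀ y ∈ m, x ≠ y ∧ (G.Adj x y ↔
      (l.getLast? = some x ∧ m.head? = some y) ∨ (l.head? = some x ∧ m.getLast? = some y))) :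
    Odd (l.length + m.length) := by
  cases l with
  | nil => exact absurd rfl hl0
  | cons v l =>
    have hvl : ∀ x ∈ l, x ≠ v := fun x hx hxv => (hl.2 x hx).1 hxv.symm
    have hp : IndPath G (l ++ m) := by
      rw [indPath_append]
      refine ⟨hl.1, hm, fun x hx y hy => ?_⟩
      obtain ⟨h1, h2⟩ := h x (by simp [hx]) y hy
      refine ⟨h1, h2.trans ?_⟩
      cases l with
      | nil => simp at hx
      | cons z l =>
        have := hvl x hx
        simp [List.getLast?_cons_cons, this.symm]
    have := hG.even_length (v := v) hp (by simp at h3 ⊢; omega) ?_ ?_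
    · rw [List.length_append] at this
      rw [List.length_cons, add_right_comm]
      exact this.add_one
    · rw [List.mem_append]
      rintro (hv | hv)
      · exact hvl v hv rfl
      · exact (h v (by simp) v hv).1 rfl
    · intro x hx
      rw [List.mem_append] at hx
      have hmx : ∀ x ∈ l, m.getLast? ≠ some x := fun x hx hm' =>
        (h x (by simp [hx]) x (List.mem_of_getLast? hm')).1 rfl
      have hlx : ∀ x ∈ m, l.head? ≠ some x := fun x hx hm' =>
        (h x (by simp [List.mem_of_head? hm']) x hx).1 rfl
      have hmlast : (l ++ m).getLast? = m.getLast? := by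
        rw [List.getLast?_append_of_ne_nil _ hm0]
      rw [hmlast]
      rcases hx with hx | hx
      · rw [(hl.2 x hx).2, List.head?_append_of_ne_nil _ (List.ne_nil_of_mem hx)]
        simp [hmx x hx]
      · rw [(h v (by simp) x hx).2]
        cases l with
        | nil => simp
        | cons z l =>
          have h1 := hlx x hx
          have h2 : (z :: l).getLast? ≠ some v := fun h =>
            hvl v (List.mem_of_getLast? h) rfl
          rw [List.getLast?_cons_cons]
          simp at h1
          simp [h2, h1]

/-- An even-hole-free graph contains no theta. -/
theorem EvenHoleFree.no_theta {G : SimpleGraph V} (hG : EvenHoleFree G) {a w : V}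
    {L₁ L₂ L₃ : List V} (haw : ¬ G.Adj a w)
    (h₁ : IndPath G (a :: (L₁ ++ [w]))) (h₂ : IndPath G (a :: (L₂ ++ [w])))
    (h₃ : IndPath G (a :: (L₃ ++ [w])))
    (h₁₂ : ∀ x ∈ L₁, ∀ y ∈ L₂, x ≠ y ∧ ¬ G.Adj x y)
    (h₁₃ : ∀ x ∈ L₁, ∀ y ∈ L₃, x ≠ y ∧ ¬ G.Adj x y)
    (h₂₃ : ∀ x ∈ L₂, ∀ y ∈ L₃, x ≠ y ∧ ¬ G.Adj x y) : False := by
  have hne : ∀ L : List V, IndPath G (a :: (L ++ [w])) → L ≠ [] := by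
    rintro L hL rfl
    exact haw ((hL.2 w (by simp)).2.2 rfl)
  have key : ∀ L M : List V, IndPath G (a :: (L ++ [w])) → IndPath G (a :: (M ++ [w])) →
      (∀ x ∈ L, ∀ y ∈ M, x ≠ y ∧ ¬ G.Adj x y) → Odd (L.length + M.length) := by
    intro L M hL hM hLM
    have hM0 := hne M hM
    have hMw := hM.1
    rw [indPath_append] at hMw
    have := hG.odd_ring (l := a :: (L ++ [w])) (m := M.reverse) hL hMw.1.reverse (by simp)
      (by simpa using hM0) (by simp; have := List.length_pos_of_ne_nil hM0; omega) ?_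
    · simp only [List.length_cons, List.length_append, List.length_nil, List.length_reverse] at this
      rw [show L.length + (0 + 1) + 1 + M.length = L.length + M.length + 2 by ring] at this
      simpa [Nat.odd_add, parity_simps] using this
    · intro x hx y hy
      have hyM : y ∈ M := by simpa using hy
      have hay := hM.2 y (by simp [hyM])
      have hyw := hMw.2.2 y hyM w (by simp)
      have haw' := (hM.2 w (by simp)).1
      rw [List.head?_append_of_ne_nil _ hM0] at hay
      simp only [List.mem_cons, List.mem_append, List.not_mem_nil, or_false] at hx
      have hlast : (a :: (L ++ [w])).getLast? = some w := by
        rw [← List.cons_append, List.getLast?_concat]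
      rw [hlast]
      simp only [List.head?_reverse, List.getLast?_reverse, List.head?_cons, Option.some_inj]
      rcases hx with rfl | hx | rfl
      · simp [hay, haw'.symm]
      · have h1 := hLM x hx y hyM
        have hL1 := hL.2 x (by simp [hx])
        have hL2 := hL.1
        rw [indPath_append] at hL2
        have hL3 := hL2.2.2 x hx w (by simp)
        simp [h1, hL1, hL3.1.symm]
      · refine ⟨hyw.1.symm, ?_⟩
        rw [G.adj_comm]
        simp [hyw.2, haw']
  have h1 := key _ _ h₁ h₂ h₁₂
  have h2 := key _ _ h₁ h₃ h₁₃
  have h3 := key _ _ h₂ h₃ h₂₃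
  rw [Nat.odd_iff] at h1 h2 h3
  omega
theorem IndPath.append {G : SimpleGraph V} {l m : List V} {u v : V} (hl : IndPath G l)
    (hm : IndPath G m) (hu : l.getLast? = some u) (hv : m.head? = some v) (huv : G.Adj u v)
    (h : ∀ x ∈ l, ∀ y ∈ m, x ≠ y ∧ (G.Adj x y → x = u ∧ y = v)) : IndPath G (l ++ m) := by
  rw [indPath_append]
  refine ⟨hl, hm, fun x hx y hy => ⟨(h x hx y hy).1, ?_⟩⟩
  rw [hu, hv, Option.some_inj, Option.some_inj]
  constructor
  · intro hxy
    exact ⟨((h x hx y hy).2 hxy).1.symm, ((h x hx y hy).2 hxy).2.symm⟩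
  · rintro ⟨rfl, rfl⟩
    exact huv

theorem exists_first {p : V → Prop} {l : List V} (h : ∃ x ∈ l, p x) :
    ∃ l₁ x l₂, l = l₁ ++ x :: l₂ ∧ p x ∧ ∀ z ∈ l₁, ¬ p z := by
  induction l with
  | nil => simp at h
  | cons u l ih =>
    by_cases hu : p u
    · exact ⟨[], u, l, rfl, hu, by simp⟩
    · obtain ⟨l₁, x, l₂, rfl, hx, hl⟩ := ih (by simpa [hu] using h)
      exact ⟨u :: l₁, x, l₂, rfl, hx, by simpa [hu] using hl⟩

theorem exists_last {p : V → Prop} {l : List V} (h : ∃ x ∈ l, p x) :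
    ∃ l₁ x l₂, l = l₁ ++ x :: l₂ ∧ p x ∧ ∀ z ∈ l₂, ¬ p z := by
  obtain ⟨l₁, x, l₂, h1, h2, h3⟩ := exists_first (p := p) (l := l.reverse) (by simpa using h)
  refine ⟨l₂.reverse, x, l₁.reverse, ?_, h2, by simpa using h3⟩
  rw [← List.reverse_inj, h1]
  simp

/-- A pyramid with apex `a`, given by the vertex lists `R₁,R₂,R₃` of its constituent paths
without `a`, and an induced path `P` that joins `R₁` to `R₂`. -/
structure LinkedPyramid (G : SimpleGraph V) (a : V) (R₁ R₂ R₃ P : List V)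
    (b₁ b₂ b₃ u w : V) : Prop where
  path₁ : IndPath G (a :: R₁)
  path₂ : IndPath G (a :: R₂)
  path₃ : IndPath G (a :: R₃)
  last₁ : R₁.getLast? = some b₁
  last₂ : R₂.getLast? = some b₂
  last₃ : R₃.getLast? = some b₃
  sep₁₂ : ∀ x ∈ R₁, ∀ y ∈ R₂, x ≠ y ∧ (G.Adj x y ↔ x = b₁ ∧ y = b₂)
  sep₁₃ : ∀ x ∈ R₁, ∀ y ∈ R₃, x ≠ y ∧ (G.Adj x y ↔ x = b₁ ∧ y = b₃)
  sep₂₃ : ∀ x ∈ R₂, ∀ y ∈ R₃, x ≠ y ∧ (G.Adj x y ↔ x = b₂ ∧ y = b₃)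
  path : IndPath G P
  head : P.head? = some u
  last : P.getLast? = some w
  apex : ∀ m ∈ P, m ≠ a ∧ ¬ G.Adj a m
  link₁ : ∀ m ∈ P, ∀ x ∈ R₁, m ≠ x ∧ (G.Adj m x → m = u)
  link₂ : ∀ m ∈ P, ∀ x ∈ R₂, m ≠ x ∧ (G.Adj m x → m = w)
  link₃ : ∀ m ∈ P, ∀ x ∈ R₃, m ≠ x ∧ ¬ G.Adj m x
  head_adj : ∃ x ∈ R₁, x ≠ b₁ ∧ G.Adj u x
  last_adj : ∃ x ∈ R₂, x ≠ b₂ ∧ G.Adj w x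

namespace LinkedPyramid

variable {G : SimpleGraph V} {a : V} {R₁ R₂ R₃ P : List V} {b₁ b₂ b₃ u w : V}

theorem symm (h : LinkedPyramid G a R₁ R₂ R₃ P b₁ b₂ b₃ u w) :
    LinkedPyramid G a R₂ R₁ R₃ P.reverse b₂ b₁ b₃ w u where
  path₁ := h.path₂
  path₂ := h.path₁
  path₃ := h.path₃
  last₁ := h.last₂
  last₂ := h.last₁
  last₃ := h.last₃
  sep₁₂ x hx y hy := ⟨(h.sep₁₂ y hy x hx).1.symm, by
    rw [G.adj_comm, (h.sep₁₂ y hy x hx).2, and_comm]⟩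
  sep₁₃ := h.sep₂₃
  sep₂₃ := h.sep₁₃
  path := h.path.reverse
  head := by rw [List.head?_reverse, h.last]
  last := by rw [List.getLast?_reverse, h.head]
  apex m hm := h.apex m (List.mem_reverse.1 hm)
  link₁ m hm := h.link₂ m (List.mem_reverse.1 hm)
  link₂ m hm := h.link₁ m (List.mem_reverse.1 hm)
  link₃ m hm := h.link₃ m (List.mem_reverse.1 hm)
  head_adj := h.last_adj
  last_adj := h.head_adj

theorem exists_path_to_apex (h : LinkedPyramid G a R₁ R₂ R₃ P b₁ b₂ b₃ u w) :
    ∃ X x X', R₁ = X ++ x :: X' ∧ G.Adj u x ∧ (∀ z ∈ X, ¬ G.Adj u z) ∧ b₁ ∉ X ++ [x] ∧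
      IndPath G (a :: ((X ++ [x]) ++ P)) := by
  obtain ⟨X, x, X', hR, hx, hX⟩ := exists_first (p := fun x => G.Adj u x)
    (by obtain ⟨x, hx, -, h2⟩ := h.head_adj; exact ⟨x, hx, h2⟩)
  have hP1 := h.path₁
  have hl := h.last₁
  have hb : b₁ ∉ X ++ [x] := by
    obtain ⟨y, hy, hyb, huy⟩ := h.head_adj
    have h0 := hP1.1.nodup
    cases hX' : X' with
    | nil => grind
    | cons z X'' =>
      have : b₁ ∈ X' := by
        rw [hR, List.getLast?_append_of_ne_nil _ (by simp), hX', List.getLast?_cons_cons] at hl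
        rw [hX']
        exact List.mem_of_getLast? hl
      grind
  refine ⟨X, x, X', hR, hx, hX, hb, ?_⟩
  rw [← List.cons_append]
  have h1 : IndPath G (a :: (X ++ [x])) := by
    rw [hR, List.append_cons, ← List.cons_append, indPath_append] at hP1
    exact hP1.1
  refine h1.append h.path (u := x) (v := u) ?_ h.head hx.symm ?_
  · rw [← List.cons_append, List.getLast?_concat]
  · intro z hz y hy
    have h2 := h.apex y hy
    have h3 := h.link₁ y hy z
    grind [G.adj_comm]

theorem false_of_unique_neighbor (hG : EvenHoleFree G)
    (h : LinkedPyramid G a R₁ R₂ R₃ P b₁ b₂ b₃ u w) {Y Z : List V} {y : V}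
    (hR : R₂ = Y ++ y :: Z) (hY : Y ≠ []) (hwy : G.Adj w y) (hYw : ∀ z ∈ Y, ¬ G.Adj w z)
    (hZw : ∀ z ∈ Z, ¬ G.Adj w z) : False := by
  obtain ⟨X, x, X', hR1, hux, hX, hb, hQ⟩ := h.exists_path_to_apex
  have hZ : Z ≠ [] := by
    rintro rfl
    have hl := h.last₂
    rw [hR, List.getLast?_concat] at hl
    obtain ⟨z, hz, hzb, hwz⟩ := h.last_adj
    grind
  have hbZ : Z.getLast? = some b₂ := by
    have hl := h.last₂
    rw [hR, List.getLast?_append_of_ne_nil _ (by simp)] at hl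
    cases Z with
    | nil => exact absurd rfl hZ
    | cons z Z => rwa [List.getLast?_cons_cons] at hl
  have hp2 := h.path₂
  have hnd := hp2.nodup
  have hbR : b₂ ∈ R₂ := List.mem_of_getLast? h.last₂
  have hbR3 : b₃ ∈ R₃ := List.mem_of_getLast? h.last₃
  have hay : G.Adj a y → False := by
    intro hay
    have := (hp2.2 y (by simp [hR])).2.1 hay
    rw [hR, List.head?_append_of_ne_nil _ hY] at this
    have := List.mem_of_head? this
    grind
  rw [hR, List.append_cons, ← List.cons_append] at hp2
  have hYp : IndPath G (a :: (Y ++ [y])) := (indPath_append.1 hp2).1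
  have hZp : IndPath G (y :: Z) := by
    have := h.path₂.1
    rw [hR, indPath_append] at this
    exact this.2.1
  refine hG.no_theta (a := a) (w := y) (L₁ := Y) (L₂ := (X ++ [x]) ++ P)
    (L₃ := R₃ ++ Z.reverse) hay hYp ?_ ?_ ?_ ?_ ?_
  · rw [← List.cons_append]
    refine hQ.append (u := w) (v := y) indPath_singleton ?_ rfl hwy ?_
    · rw [← List.cons_append, List.getLast?_append_of_ne_nil _
        (List.ne_nil_of_mem (List.mem_of_getLast? h.last)), h.last]
    · intro z hz y' hy'
      obtain rfl : y' = y := by simpa using hy'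
      have h1 := h.link₂ z
      have h2 := h.sep₁₂ z
      have h3 : a ≠ y' := (h.path₂.2 y' (by simp [hR])).1
      grind
  · rw [List.append_assoc, ← List.cons_append, ← List.reverse_cons]
    refine h.path₃.append (u := b₃) (v := b₂) hZp.reverse ?_ ?_ ?_ ?_
    · have := h.last₃
      cases R₃ with
      | nil => simp at this
      | cons z R => rwa [List.getLast?_cons_cons]
    · rw [List.head?_reverse]
      cases Z with
      | nil => exact absurd rfl hZ
      | cons z Z => rwa [List.getLast?_cons_cons]
    · exact ((h.sep₂₃ b₂ hbR b₃ hbR3).2.2 ⟨rfl, rfl⟩).symm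
    · intro z hz t ht
      have ht' : t ∈ y :: Z := List.mem_reverse.1 ht
      have h1 := h.sep₂₃ t (by grind) z
      have h2 := h.path₂.2 t (by grind)
      have h3 : R₂.head? ≠ some t := by
        rw [hR, List.head?_append_of_ne_nil _ hY]
        intro h4
        have := List.mem_of_head? h4
        grind
      grind [G.adj_comm]
  · intro s hs t ht
    have h1 := h.sep₁₂ t
    have h2 := h.link₂ t
    grind [G.adj_comm]
  · intro s hs t ht
    have h1 := h.sep₂₃ s (by simp [hR, hs]) t
    have h2 : s ≠ b₂ := by
      rintro rfl
      exact ((indPath_append.1 hp2).2.2 s (by simp [hs]) s (List.mem_of_getLast? hbZ)).1 rfl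
    have h0 : s ≠ y := by
      rintro rfl
      exact hYw s hs hwy
    have h3 := (indPath_append.1 hp2).2.2 s (by simp [hs]) t
    have h4 : (a :: (Y ++ [y])).getLast? = some y := by
      rw [← List.cons_append, List.getLast?_concat]
    grind only [= List.mem_append, = List.mem_cons, List.not_mem_nil, = List.mem_reverse]
  · intro s hs t ht
    have h1 := h.sep₁₃ s
    have h2 := h.sep₁₂ s
    have h3 := h.link₂ s
    have h4 := h.link₃ s
    grind only [= List.mem_append, = List.mem_cons, List.not_mem_nil, = List.mem_reverse]

theorem false_of_nonadjacent_neighbors (hG : EvenHoleFree G)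
    (h : LinkedPyramid G a R₁ R₂ R₃ P b₁ b₂ b₃ u w) {Y M Z : List V} {y y' : V}
    (hR : R₂ = Y ++ y :: M ++ y' :: Z) (hM : M ≠ []) (hwy : G.Adj w y) (hwy' : G.Adj w y')
    (hYw : ∀ z ∈ Y, ¬ G.Adj w z) (hZw : ∀ z ∈ Z, ¬ G.Adj w z) : False := by
  obtain ⟨X, x, X', hR1, hux, hX, hb, hQ⟩ := h.exists_path_to_apex
  have hwP : w ∈ P := List.mem_of_getLast? h.last
  obtain ⟨P', rfl⟩ : ∃ P', P = P' ++ [w] := by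
    have := h.last
    rw [List.getLast?_eq_some_iff] at this
    exact this
  have hbZ : (y' :: Z).getLast? = some b₂ := by
    have hl := h.last₂
    rwa [hR, List.getLast?_append_of_ne_nil _ (by simp)] at hl
  have hp2 := h.path₂
  have hnd := hp2.nodup
  have hbR : b₂ ∈ R₂ := List.mem_of_getLast? h.last₂
  have hbR3 : b₃ ∈ R₃ := List.mem_of_getLast? h.last₃
  have hsp : R₂ = (Y ++ [y]) ++ (M ++ y' :: Z) := by simp [hR]
  rw [hsp, ← List.cons_append] at hp2
  have hYp : IndPath G (a :: (Y ++ [y])) := (indPath_append.1 hp2).1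
  have hZp : IndPath G (y' :: Z) := (indPath_append.1 (indPath_append.1 hp2).2.1).2.1
  have hwP' : w ∉ P' := by
    have hPnd := h.path.nodup
    grind
  have hXR : ∀ z ∈ X ++ [x], z ∈ R₁ ∧ z ≠ b₁ := by grind
  have hYR : ∀ z ∈ Y ++ [y], z ∈ R₂ := by grind
  have hZR : ∀ z ∈ y' :: Z, z ∈ R₂ := by grind
  have hYZ : ∀ s ∈ Y ++ [y], ∀ t ∈ y' :: Z, s ≠ t ∧ ¬ G.Adj s t := by
    intro s hs t ht
    have h3 := (indPath_append.1 hp2).2.2 s (List.mem_cons_of_mem _ hs) t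
      (List.mem_append_right _ ht)
    refine ⟨h3.1, fun hst => ?_⟩
    have h4 := (h3.2.1 hst).2
    rw [List.head?_append_of_ne_nil _ hM] at h4
    have h5 := (indPath_append.1 (indPath_append.1 hp2).2.1).2.2 t (List.mem_of_mem_head? h4) t ht
    exact h5.1 rfl
  have hYb : ∀ s ∈ Y ++ [y], s ≠ b₂ := fun s hs =>
    (hYZ s hs b₂ (List.mem_of_getLast? hbZ)).1
  have haw := h.apex w hwP
  refine hG.no_theta (a := a) (w := w) (L₁ := Y ++ [y]) (L₂ := (X ++ [x]) ++ P')
    (L₃ := R₃ ++ (y' :: Z).reverse) haw.2 ?_ ?_ ?_ ?_ ?_ ?_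
  · rw [← List.cons_append]
    refine hYp.append (u := y) (v := w) indPath_singleton ?_ rfl hwy.symm ?_
    · rw [← List.cons_append, List.getLast?_concat]
    · intro z hz t ht
      have h1 := h.link₂ w hwP z
      grind [G.adj_comm]
  · rwa [List.append_assoc]
  · rw [← List.cons_append]
    refine IndPath.append (u := y') (v := w) ?_ indPath_singleton ?_ rfl hwy'.symm ?_
    · rw [← List.cons_append]
      refine h.path₃.append (u := b₃) (v := b₂) hZp.reverse ?_ ?_ ?_ ?_
      · have := h.last₃
        cases R₃ with
        | nil => simp at this
        | cons z R => rwa [List.getLast?_cons_cons]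
      · rw [List.head?_reverse, hbZ]
      · exact ((h.sep₂₃ b₂ hbR b₃ hbR3).2.2 ⟨rfl, rfl⟩).symm
      · intro z hz t ht
        have ht' : t ∈ y' :: Z := List.mem_reverse.1 ht
        have h1 := h.sep₂₃ t (by grind) z
        have h2 := h.path₂.2 t (by grind)
        have h3 : R₂.head? ≠ some t := by
          rw [hR, List.append_assoc, List.cons_append, List.append_cons,
            List.head?_append_of_ne_nil _ (by simp)]
          intro h4
          have := List.mem_of_head? h4
          grind
        grind [G.adj_comm]
    · rw [← List.cons_append, List.getLast?_append_of_ne_nil _ (by simp)]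
      simp
    · intro z hz t ht
      have h1 := h.link₃ w hwP z
      have h2 := h.link₂ w hwP z
      grind [G.adj_comm]
  · intro s hs t ht
    have h1 := h.sep₁₂ t
    have h2 := h.link₂ t
    have h3 := hXR t
    have h4 := hYR s hs
    grind only [= List.mem_append, = List.mem_cons, List.not_mem_nil, = List.mem_reverse, G.adj_comm]
  · intro s hs t ht
    have h1 := h.sep₂₃ s (hYR s hs) t
    have h2 := hYb s hs
    have h3 := hYZ s hs t
    grind only [= List.mem_append, = List.mem_cons, List.not_mem_nil, = List.mem_reverse]
  · intro s hs t ht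
    have h1 := h.sep₁₃ s
    have h2 := h.sep₁₂ s
    have h3 := h.link₂ s
    have h4 := h.link₃ s
    have h5 := hXR s
    have h6 := hZR t
    grind only [= List.mem_append, = List.mem_cons, List.not_mem_nil, = List.mem_reverse]

/-- The neighbours of `w` in `R₂` are either just its first vertex, or two consecutive ones. -/
theorem neighbors_cases (hG : EvenHoleFree G)
    (h : LinkedPyramid G a R₁ R₂ R₃ P b₁ b₂ b₃ u w) :
    (∃ y Z, R₂ = y :: Z ∧ Z ≠ [] ∧ G.Adj w y ∧ ∀ z ∈ Z, ¬ G.Adj w z) ∨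
    (∃ Y y y' Z, R₂ = Y ++ y :: y' :: Z ∧ G.Adj w y ∧ G.Adj w y' ∧
      (∀ z ∈ Y, ¬ G.Adj w z) ∧ ∀ z ∈ Z, ¬ G.Adj w z) := by
  obtain ⟨Y, y, Z, hR, hy, hY⟩ := exists_first (p := fun x => G.Adj w x)
    (by obtain ⟨x, hx, -, h2⟩ := h.last_adj; exact ⟨x, hx, h2⟩)
  by_cases hZ : ∃ z ∈ Z, G.Adj w z
  · obtain ⟨M, y', Z', hZ', hy', hZw⟩ := exists_last (p := fun x => G.Adj w x) hZ
    rcases eq_or_ne M [] with rfl | hM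
    · exact Or.inr ⟨Y, y, y', Z', by simp [hR, hZ'], hy, hy', hY, hZw⟩
    · exact (h.false_of_nonadjacent_neighbors hG (by simp [hR, hZ']) hM hy hy' hY hZw).elim
  · push Not at hZ
    rcases eq_or_ne Y [] with rfl | hYn
    · refine Or.inl ⟨y, Z, hR, ?_, hy, hZ⟩
      rintro rfl
      have := h.last₂
      obtain ⟨x, hx, hxb, -⟩ := h.last_adj
      subst hR
      simp at this hx
      exact hxb (hx.trans this)
    · exact (h.false_of_unique_neighbor hG hR hYn hy hY hZ).elim
theorem last_notMem (h : LinkedPyramid G a R₁ R₂ R₃ P b₁ b₂ b₃ u w)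
    {X X' : List V} {x : V} (hX : R₁ = X ++ x :: X') (huX : ∀ t ∈ X, ¬ G.Adj u t) :
    b₁ ∉ X ++ [x] := by
  intro hb
  obtain ⟨z, hz, hzb, huz⟩ := h.head_adj
  have hl := h.last₁
  have hnd := h.path₁.1.nodup
  have hX' : X' = [] := by
    cases hX' : X' with
    | nil => rfl
    | cons z X'' =>
      have : b₁ ∈ X' := by
        rw [hX, List.getLast?_append_of_ne_nil _ (by simp), hX', List.getLast?_cons_cons] at hl
        rw [hX']
        exact List.mem_of_getLast? hl
      grind
  rw [hX, hX', List.getLast?_concat, Option.some_inj] at hl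
  rw [hX, hX', List.mem_append, List.mem_singleton] at hz
  rcases hz with hz | hz
  · exact huX z hz huz
  · exact hzb (hz.trans hl)

theorem odd_ring_add (hG : EvenHoleFree G) (h : LinkedPyramid G a R₁ R₂ R₃ P b₁ b₂ b₃ u w)
    {X X' Y Y' : List V} {x y : V}
    (hX : R₁ = X ++ x :: X') (hux : G.Adj u x) (huX : ∀ t ∈ X, ¬ G.Adj u t)
    (hY : R₂ = Y ++ y :: Y') (hwy : G.Adj w y) (hwY : ∀ t ∈ Y, ¬ G.Adj w t) :
    Odd (P.length + (((Y ++ [y]).reverse ++ a :: (X ++ [x])).length)) := by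
  have hP0 : P ≠ [] := List.ne_nil_of_mem (List.mem_of_mem_head? h.head)
  have hb₁ := h.last_notMem hX huX
  have hb₂ := h.symm.last_notMem hY hwY
  have hXR : ∀ z ∈ X ++ [x], z ∈ R₁ ∧ z ≠ b₁ := by grind
  have hYR : ∀ z ∈ Y ++ [y], z ∈ R₂ ∧ z ≠ b₂ := by grind
  have hXp : IndPath G (a :: (X ++ [x])) := by
    have := h.path₁
    rw [hX, List.append_cons, ← List.cons_append, indPath_append] at this
    exact this.1
  have hYp : IndPath G (a :: (Y ++ [y])) := by
    have := h.path₂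
    rw [hY, List.append_cons, ← List.cons_append, indPath_append] at this
    exact this.1
  have hhd : ((Y ++ [y]).reverse ++ a :: (X ++ [x])).head? = some y := by simp
  have hlt : ((Y ++ [y]).reverse ++ a :: (X ++ [x])).getLast? = some x := by
    rw [List.getLast?_append_of_ne_nil _ (by simp), ← List.cons_append, List.getLast?_concat]
  refine hG.odd_ring h.path ?_ hP0 (by simp) (by simp; omega) ?_
  · rw [indPath_append]
    refine ⟨hYp.1.reverse, hXp, ?_⟩
    intro s hs t ht
    rw [List.mem_reverse] at hs
    rw [List.getLast?_reverse, List.head?_cons]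
    rcases List.mem_cons.1 ht with rfl | ht
    · have := hYp.2 s hs
      rw [G.adj_comm]
      exact ⟨this.1.symm, by simpa using this.2⟩
    · have h1 := h.sep₁₂ t (hXR t ht).1 s (hYR s hs).1
      have h2 := hXp.2 t ht
      have h3 := hXR t ht
      grind [G.adj_comm]
  · intro s hs t ht
    rw [h.last, h.head, hhd, hlt]
    have h1 := h.apex s hs
    have h2 := h.link₁ s hs t
    have h3 := h.link₂ s hs t
    have hy := hYR t
    have hx := hXR t
    have h4 : t ∈ Y ++ [y] → t ∉ X ++ [x] := fun h1 h2 =>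
      (h.sep₁₂ t (hXR t h2).1 t (hYR t h1).1).1 rfl
    have h5 : y ∉ X ++ [x] := fun h2 =>
      (h.sep₁₂ y (hXR y h2).1 y (hYR y (by simp)).1).1 rfl
    have h6 : x ∉ Y ++ [y] := fun h2 =>
      (h.sep₁₂ x (hXR x (by simp)).1 x (hYR x h2).1).1 rfl
    have h7 := (hXp.2 x (by simp)).1
    have h8 := (hYp.2 y (by simp)).1
    have h9 : t ∈ X → ¬ G.Adj u t := huX t
    have h10 : t ∈ Y → ¬ G.Adj w t := hwY t
    grind only [= List.mem_append, = List.mem_cons, List.not_mem_nil, = List.mem_reverse, G.adj_comm]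

theorem odd_base_ring_add (hG : EvenHoleFree G) (h : LinkedPyramid G a R₁ R₂ R₃ P b₁ b₂ b₃ u w)
    {W W' Z Z' : List V} {x' y' : V}
    (hW : R₁ = W ++ x' :: W') (hux' : G.Adj u x') (huW : ∀ t ∈ W', ¬ G.Adj u t)
    (hZ : R₂ = Z ++ y' :: Z') (hwy' : G.Adj w y') (hwZ : ∀ t ∈ Z', ¬ G.Adj w t) :
    Odd (P.length + ((y' :: Z') ++ (x' :: W').reverse).length) := by
  have hP0 : P ≠ [] := List.ne_nil_of_mem (List.mem_of_mem_head? h.head)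
  have hWR : ∀ z ∈ x' :: W', z ∈ R₁ := by grind
  have hZR : ∀ z ∈ y' :: Z', z ∈ R₂ := by grind
  have hWp : IndPath G (x' :: W') := by
    have := h.path₁.1
    rw [hW, indPath_append] at this
    exact this.2.1
  have hZp : IndPath G (y' :: Z') := by
    have := h.path₂.1
    rw [hZ, indPath_append] at this
    exact this.2.1
  have hl₁ : (x' :: W').getLast? = some b₁ := by
    rw [← h.last₁, hW, List.getLast?_append_of_ne_nil _ (by simp)]
  have hl₂ : (y' :: Z').getLast? = some b₂ := by
    rw [← h.last₂, hZ, List.getLast?_append_of_ne_nil _ (by simp)]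
  have hlt : ((y' :: Z') ++ (x' :: W').reverse).getLast? = some x' := by
    rw [List.getLast?_append_of_ne_nil _ (by simp), List.getLast?_reverse, List.head?_cons]
  refine hG.odd_ring h.path ?_ hP0 (by simp) ?_ ?_
  · rw [indPath_append]
    refine ⟨hZp, hWp.reverse, ?_⟩
    intro s hs t ht
    rw [List.mem_reverse] at ht
    rw [List.head?_reverse, hl₁, hl₂]
    have h1 := h.sep₁₂ t (hWR t ht) s (hZR s hs)
    grind [G.adj_comm]
  · have := List.length_pos_of_ne_nil hP0
    simp; omega
  · intro s hs t ht
    rw [h.last, h.head, hlt]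
    have h2 := h.link₁ s hs t
    have h3 := h.link₂ s hs t
    have hy := hZR t
    have hx := hWR t
    have h4 : t ∈ y' :: Z' → t ∉ x' :: W' := fun h1 h2 =>
      (h.sep₁₂ t (hWR t h2) t (hZR t h1)).1 rfl
    have h5 : y' ∉ x' :: W' := fun h2 =>
      (h.sep₁₂ y' (hWR y' h2) y' (hZR y' (by simp))).1 rfl
    have h6 : x' ∉ y' :: Z' := fun h2 =>
      (h.sep₁₂ x' (hWR x' (by simp)) x' (hZR x' h2)).1 rfl
    have h9 : t ∈ W' → ¬ G.Adj u t := huW t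
    have h10 : t ∈ Z' → ¬ G.Adj w t := hwZ t
    rw [List.cons_append, List.head?_cons]
    grind only [= List.mem_append, = List.mem_cons, List.not_mem_nil, = List.mem_reverse, G.adj_comm]

theorem odd_rungs_ring (hG : EvenHoleFree G) (h : LinkedPyramid G a R₁ R₂ R₃ P b₁ b₂ b₃ u w) :
    Odd ((a :: R₁).length + R₂.reverse.length) := by
  have h1 : R₁ ≠ [] := List.ne_nil_of_mem (List.mem_of_getLast? h.last₁)
  have h2 : R₂ ≠ [] := List.ne_nil_of_mem (List.mem_of_getLast? h.last₂)
  have hl : (a :: R₁).getLast? = some b₁ := by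
    rw [← h.last₁]
    cases R₁ with
    | nil => exact absurd rfl h1
    | cons z R => rw [List.getLast?_cons_cons]
  refine hG.odd_ring h.path₁ h.path₂.1.reverse (by simp) (by simpa) ?_ ?_
  · have := List.length_pos_of_ne_nil h1
    have := List.length_pos_of_ne_nil h2
    simp; omega
  · intro s hs t ht
    rw [List.mem_reverse] at ht
    rw [hl, List.head?_reverse, List.getLast?_reverse, h.last₂, List.head?_cons]
    have h4 := h.path₂.2 t ht
    have h6 : b₁ ∈ R₁ := List.mem_of_getLast? h.last₁
    have h7 := h.path₁.2 b₁ h6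
    rcases List.mem_cons.1 hs with rfl | hs
    · grind
    · have h5 := h.sep₁₂ s hs t ht
      have h8 := h.path₁.2 s hs
      grind

/-- Lengths of the parts of `R₁` and `R₂` cut off by the extreme neighbours of `u` and `w`. -/
theorem odd_add (hG : EvenHoleFree G) (h : LinkedPyramid G a R₁ R₂ R₃ P b₁ b₂ b₃ u w)
    {X X' W W' Y Y' Z Z' : List V} {x x' y y' : V}
    (hX : R₁ = X ++ x :: X') (hux : G.Adj u x) (huX : ∀ t ∈ X, ¬ G.Adj u t)
    (hW : R₁ = W ++ x' :: W') (hux' : G.Adj u x') (huW : ∀ t ∈ W', ¬ G.Adj u t)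
    (hY : R₂ = Y ++ y :: Y') (hwy : G.Adj w y) (hwY : ∀ t ∈ Y, ¬ G.Adj w t)
    (hZ : R₂ = Z ++ y' :: Z') (hwy' : G.Adj w y') (hwZ : ∀ t ∈ Z', ¬ G.Adj w t) :
    Odd (X.length + W.length + Y.length + Z.length) := by
  have h1 := h.odd_ring_add hG hX hux huX hY hwy hwY
  have h2 := h.odd_rungs_ring hG
  have h3 := h.odd_base_ring_add hG hW hux' huW hZ hwy' hwZ
  have h4 := congrArg List.length hW
  have h5 := congrArg List.length hZ
  simp only [List.length_append, List.length_cons, List.length_reverse, List.length_nil] at *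
  rw [Nat.odd_iff] at *
  omega

theorem extNearPrismCrossEnd (h : LinkedPyramid G a R₁ R₂ R₃ P b₁ b₂ b₃ u w)
    {X X' Z : List V} {x x' y : V} (hX : R₁ = X ++ x :: x' :: X') (hux : G.Adj u x)
    (hux' : G.Adj u x') (huX : ∀ t ∈ X, ¬ G.Adj u t) (huX' : ∀ t ∈ X', ¬ G.Adj u t)
    (hZ : R₂ = y :: Z) (hZ0 : Z ≠ []) (hwy : G.Adj w y) (hwZ : ∀ t ∈ Z, ¬ G.Adj w t) :
    ExtNearPrismCrossEnd G a := by
  have hb₁ := h.last_notMem hX huX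
  have hXR : ∀ z ∈ X ++ [x], z ∈ R₁ ∧ z ≠ b₁ := by grind
  have hXR' : ∀ z ∈ x' :: X', z ∈ R₁ := by grind
  have hbR₂ : b₂ ∈ R₂ := List.mem_of_getLast? h.last₂
  have hbR₃ : b₃ ∈ R₃ := List.mem_of_getLast? h.last₃
  have hbX' : b₁ ∈ x' :: X' := by
    have : b₁ ∈ R₁ := List.mem_of_getLast? h.last₁
    grind
  have huP : u ∈ P := List.mem_of_mem_head? h.head
  have hp₁ : IndPath G ((a :: (X ++ [x])) ++ (x' :: X')) := by
    have := h.path₁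
    rwa [hX, List.append_cons, ← List.cons_append] at this
  have hcr := (indPath_append.1 hp₁).2.2
  have hlast : (a :: (X ++ [x])).getLast? = some x := by
    rw [← List.cons_append, List.getLast?_concat]
  have hax : a ≠ x := (hp₁.2 x (by simp)).1
  have hR₃0 : R₃ ≠ [] := List.ne_nil_of_mem hbR₃
  have hp2 := h.path₂
  rw [hZ] at hp2
  have hay : G.Adj a y := (hp2.2 y (by simp)).2.2 rfl
  have hl₂ : Z.getLast? = some b₂ := by
    have := h.last₂
    rw [hZ] at this
    cases Z with
    | nil => exact absurd rfl hZ0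
    | cons z R => rwa [List.getLast?_cons_cons] at this
  have hyb : y ≠ b₂ := (hp2.1.2 b₂ (List.mem_of_getLast? hl₂)).1
  have hL₁ : IndPath G ((X ++ [x]).reverse ++ a :: R₃) := by
    have hXa := (indPath_append.1 hp₁).1
    rw [indPath_append]
    refine ⟨hXa.1.reverse, h.path₃, ?_⟩
    intro s hs t ht
    rw [List.mem_reverse] at hs
    rw [List.getLast?_reverse, List.head?_cons]
    rcases List.mem_cons.1 ht with rfl | ht
    · have := hXa.2 s hs
      rw [G.adj_comm]
      exact ⟨this.1.symm, by simpa using this.2⟩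
    · have h1 := h.sep₁₃ s (hXR s hs).1 t ht
      have h2 := h.path₃.2 t ht
      have h3 := hXR s hs
      grind
  have hL₂ : IndPath G (P ++ R₂) := by
    refine h.path.append (u := w) (v := y) h.path₂.1 h.last (by simp [hZ]) hwy ?_
    intro s hs t ht
    have h1 := h.link₂ s hs t ht
    refine ⟨h1.1, fun h2 => ⟨h1.2 h2, ?_⟩⟩
    have h3 := h1.2 h2
    subst h3
    by_contra hne
    exact hwZ t (by grind) h2
  have hL₃ : IndPath G (x' :: X') := (indPath_append.1 hp₁).2.1
  obtain ⟨w₁, hw₁, hwp₁, hwi₁⟩ := hL₁.exists_walk (u := x) (v := b₃) (by simp) (by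
    rw [List.getLast?_append_of_ne_nil _ (by simp)]
    have := h.last₃
    cases R₃ with
    | nil => exact absurd rfl hR₃0
    | cons z R => rwa [List.getLast?_cons_cons])
  obtain ⟨w₂, hw₂, hwp₂, hwi₂⟩ := hL₂.exists_walk (u := u) (v := b₂)
    (by rw [List.head?_append_of_ne_nil _ (List.ne_nil_of_mem huP), h.head])
    (by rw [List.getLast?_append_of_ne_nil _ (List.ne_nil_of_mem hbR₂), h.last₂])
  obtain ⟨w₃, hw₃, hwp₃, hwi₃⟩ := hL₃.exists_walk (u := x') (v := b₁) rfl (by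
    have := h.last₁
    rwa [hX, List.append_cons, List.getLast?_append_of_ne_nil _ (by simp)] at this)
  have hm₁ : ∀ z, z ∈ w₁.support ↔ z ∈ X ++ [x] ∨ z = a ∨ z ∈ R₃ := by
    intro z; rw [hw₁]; simp only [List.mem_append, List.mem_reverse, List.mem_cons]
  have hm₂ : ∀ z, z ∈ w₂.support ↔ z ∈ P ∨ z ∈ R₂ := by
    intro z; rw [hw₂, List.mem_append]
  have hm₃ : ∀ z, z ∈ w₃.support ↔ z ∈ x' :: X' := by
    intro z; rw [hw₃]
  have haR₁ : ∀ z ∈ x' :: X', z ≠ a ∧ ¬ G.Adj a z := by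
    intro z hz
    have h1 := hcr a (by simp) z hz
    rw [hlast] at h1
    exact ⟨h1.1.symm, fun h2 => hax (by simpa using (h1.2.1 h2).1.symm)⟩
  have c₁₂ : ∀ p ∈ w₁.support, ∀ q ∈ w₂.support, p ≠ q ∧
      (G.Adj p q → (p = x ∧ q = u) ∨ (p = b₃ ∧ q = b₂) ∨ (p = a ∧ q = y)) := by
    intro p hp q hq
    rw [hm₁] at hp
    rw [hm₂] at hq
    rcases hp with hp | rfl | hp <;> rcases hq with hq | hq
    · have h1 := h.link₁ q hq p (hXR p hp).1
      have h2 := huX p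
      grind [G.adj_comm]
    · have h1 := h.sep₁₂ p (hXR p hp).1 q hq
      have h2 := hXR p hp
      grind
    · have h1 := h.apex q hq
      grind
    · have h1 := h.path₂.2 q hq
      refine ⟨h1.1, fun h2 => ?_⟩
      have := h1.2.1 h2
      rw [hZ, List.head?_cons, Option.some_inj] at this
      simp [this]
    · have h1 := h.link₃ q hq p hp
      grind [G.adj_comm]
    · have h1 := h.sep₂₃ q hq p hp
      grind [G.adj_comm]
  have c₁₃ : ∀ p ∈ w₁.support, ∀ q ∈ w₃.support, p ≠ q ∧
      (G.Adj p q → (p = x ∧ q = x') ∨ (p = b₃ ∧ q = b₁)) := by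
    intro p hp q hq
    rw [hm₁] at hp
    rw [hm₃] at hq
    rcases hp with hp | rfl | hp
    · have h1 := hcr p (List.mem_cons_of_mem _ hp) q hq
      rw [hlast] at h1
      refine ⟨h1.1, fun h2 => ?_⟩
      have := h1.2.1 h2
      rw [List.head?_cons] at this
      simp_all
    · have := haR₁ q hq
      grind
    · have h1 := h.sep₁₃ q (hXR' q hq) p hp
      grind [G.adj_comm]
  have c₂₃ : ∀ p ∈ w₂.support, ∀ q ∈ w₃.support, p ≠ q ∧
      (G.Adj p q → (p = u ∧ q = x') ∨ (p = b₂ ∧ q = b₁)) := by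
    intro p hp q hq
    rw [hm₂] at hp
    rw [hm₃] at hq
    rcases hp with hp | hp
    · have h1 := h.link₁ p hp q (hXR' q hq)
      have h2 := huX' q
      grind
    · have h1 := h.sep₁₂ q (hXR' q hq) p hp
      grind [G.adj_comm]
  have hxx' : G.Adj x x' := (hcr x (by simp) x' (by simp)).2.2 ⟨hlast, rfl⟩
  have hx₁ : x ∈ w₁.support := w₁.start_mem_support
  have ha₁ : a ∈ w₁.support := (hm₁ a).2 (Or.inr (Or.inl rfl))
  have hx₃ : x' ∈ w₃.support := w₃.start_mem_support
  have hb₃₁ : b₃ ∈ w₁.support := w₁.end_mem_support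
  have hb₂₂ : b₂ ∈ w₂.support := w₂.end_mem_support
  have hb₁₃ : b₁ ∈ w₃.support := w₃.end_mem_support
  have hu₂ : u ∈ w₂.support := w₂.start_mem_support
  have hy₂ : y ∈ w₂.support := (hm₂ y).2 (Or.inr (by simp [hZ]))
  have hxb₃ : x ≠ b₃ := (h.sep₁₃ x (hXR x (by simp)).1 b₃ hbR₃).1
  have hub₂ : u ≠ b₂ := (h.link₂ u huP b₂ hbR₂).1
  refine ⟨x, u, x', b₃, b₂, b₁, w₁, w₂, w₃, y, Or.inl ⟨hux.symm, hxx', hux', ?_, ?_, ?_, ?_,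
    hwp₁, hwp₂, hwp₃, fun v h1 h2 => (c₁₂ v h1 v h2).1 rfl,
    fun v h1 h2 => (c₁₃ v h1 v h2).1 rfl, fun v h1 h2 => (c₂₃ v h1 v h2).1 rfl,
    ha₁, hax, (h.path₃.2 b₃ hbR₃).1, hy₂, ?_, hyb, hay, ?_⟩⟩
  · exact ((h.sep₂₃ b₂ hbR₂ b₃ hbR₃).2.2 ⟨rfl, rfl⟩).symm
  · exact ((h.sep₁₃ b₁ (hXR' _ hbX') b₃ hbR₃).2.2 ⟨rfl, rfl⟩).symm
  · exact ((h.sep₁₂ b₁ (hXR' _ hbX') b₂ hbR₂).2.2 ⟨rfl, rfl⟩).symm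
  · have e1 := (c₁₂ x hx₁ b₂ hb₂₂).1
    have e2 := (c₁₃ x hx₁ b₁ hb₁₃).1
    have e3 := (c₁₂ b₃ hb₃₁ u hu₂).1
    have e4 := (c₂₃ u hu₂ b₁ hb₁₃).1
    have e5 := (c₁₃ b₃ hb₃₁ x' hx₃).1
    have e6 := (c₂₃ b₂ hb₂₂ x' hx₃).1
    ext z
    simp only [Set.mem_inter_iff, Set.mem_insert_iff, Set.mem_singleton_iff]
    grind only
  · exact (h.link₂ u huP y (by simp [hZ])).1.symm
  · intro p q hp hq hpq
    rcases hp with hp | hp | hp <;> rcases hq with hq | hq | hq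
    · exact Or.inl (hwi₁ p q hp hq hpq)
    · rcases (c₁₂ p hp q hq).2 hpq with ⟨rfl, rfl⟩ | ⟨rfl, rfl⟩ | ⟨rfl, rfl⟩ <;> simp
    · rcases (c₁₃ p hp q hq).2 hpq with ⟨rfl, rfl⟩ | ⟨rfl, rfl⟩ <;> simp
    · rcases (c₁₂ q hq p hp).2 hpq.symm with ⟨rfl, rfl⟩ | ⟨rfl, rfl⟩ | ⟨rfl, rfl⟩ <;>
        simp [Sym2.eq_swap]
    · exact Or.inr (Or.inl (hwi₂ p q hp hq hpq))
    · rcases (c₂₃ p hp q hq).2 hpq with ⟨rfl, rfl⟩ | ⟨rfl, rfl⟩ <;> simp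
    · rcases (c₁₃ q hq p hp).2 hpq.symm with ⟨rfl, rfl⟩ | ⟨rfl, rfl⟩ <;> simp [Sym2.eq_swap]
    · rcases (c₂₃ q hq p hp).2 hpq.symm with ⟨rfl, rfl⟩ | ⟨rfl, rfl⟩ <;> simp [Sym2.eq_swap]
    · exact Or.inr (Or.inr (Or.inl (hwi₃ p q hp hq hpq)))

/-- A pyramid linked in this way forces an extended near-prism with `a` in its cross-edge. -/
theorem extNearPrismCrossEnd_of_evenHoleFree (h : LinkedPyramid G a R₁ R₂ R₃ P b₁ b₂ b₃ u w)
    (hG : EvenHoleFree G) : ExtNearPrismCrossEnd G a := by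
  rcases h.symm.neighbors_cases hG with
    ⟨x, X', hX, hX0, hux, huX⟩ | ⟨X, x, x', X', hX, hux, hux', huX, huX'⟩ <;>
  rcases h.neighbors_cases hG with
    ⟨y, Z', hZ, hZ0, hwy, hwZ⟩ | ⟨Z, y, y', Z', hZ, hwy, hwy', hwZ, hwZ'⟩
  · have := h.odd_add hG (X := []) hX hux (by simp) (W := []) hX hux huX
      (Y := []) hZ hwy (by simp) (Z := []) hZ hwy hwZ
    simp at this
  · exact h.symm.extNearPrismCrossEnd hZ hwy hwy' hwZ hwZ' hX hX0 hux huX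
  · exact h.extNearPrismCrossEnd hX hux hux' huX huX' hZ hZ0 hwy hwZ
  · have := h.odd_add hG hX hux huX (W := X ++ [x]) (by simp [hX]) hux' huX'
      hZ hwy hwZ (Z := Z ++ [y]) (by simp [hZ]) hwy' hwZ'
    simp only [List.length_append, List.length_cons, List.length_nil, Nat.odd_iff] at this
    omega

end LinkedPyramid

theorem IndPath.exists_append {G : SimpleGraph V} {a u : V} {R P : List V}
    (hR : IndPath G (a :: R)) (hP : IndPath G P) (hu : P.head? = some u)
    (hPa : ∀ m ∈ P, m ≠ a ∧ ¬ G.Adj a m) (hPR : ∀ m ∈ P, ∀ x ∈ R, m ≠ x ∧ (G.Adj m x → m = u))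
    (huR : ∃ x ∈ R, G.Adj u x) :
    ∃ L, L ≠ [] ∧ (∀ z ∈ L, z ∈ R) ∧ IndPath G (a :: (L ++ P)) := by
  obtain ⟨X, x, X', rfl, hx, hX⟩ := exists_first huR
  refine ⟨X ++ [x], by simp, by grind, ?_⟩
  rw [List.append_cons, ← List.cons_append, indPath_append] at hR
  rw [← List.cons_append]
  refine hR.1.append hP (u := x) (v := u) ?_ hu hx.symm ?_
  · rw [← List.cons_append, List.getLast?_concat]
  · intro z hz y hy
    have h2 := hPa y hy
    have h3 := hPR y hy z
    grind [G.adj_comm]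

theorem ConnectedSubset.exists_indPath {G : SimpleGraph V} {F : Set V}
    (hF : ConnectedSubset G F) {x y : V} (hx : x ∈ F) (hy : y ∈ F) :
    ∃ l, IndPath G l ∧ l.head? = some x ∧ l.getLast? = some y ∧ ∀ z ∈ l, z ∈ F := by
  obtain ⟨p, hp⟩ := hF.2 x hx y hy
  clear hx hy
  induction p with
  | nil => exact ⟨_, indPath_singleton, rfl, rfl, by simpa using hp⟩
  | @cons x v y hxv p ih =>
    obtain ⟨l, hl, hlv, hly, hlF⟩ := ih fun z hz => hp z (by simp [hz])
    obtain ⟨l₁, z, l₂, rfl, hz, hl₂⟩ := exists_last (p := fun z => z = x ∨ G.Adj x z)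
      ⟨v, List.mem_of_mem_head? hlv, Or.inr hxv⟩
    rw [List.getLast?_append_of_ne_nil _ (by simp)] at hly
    have hp2 := (indPath_append.1 hl).2.1
    rcases hz with rfl | hz
    · exact ⟨z :: l₂, hp2, rfl, hly, fun t ht => hlF t (List.mem_append_right _ ht)⟩
    · refine ⟨x :: z :: l₂, ⟨hp2, ?_⟩, rfl, by rwa [List.getLast?_cons_cons], ?_⟩
      · intro t ht
        have hzx : x ≠ z := hz.ne
        rcases List.mem_cons.1 ht with rfl | ht
        · simp [hz, hzx]
        · have h1 := hl₂ t ht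
          have h2 : z ≠ t := (hp2.2 t ht).1
          grind
      · intro t ht
        have := hp x (by simp)
        grind

theorem ConnectedSubset.insert {G : SimpleGraph V} {D : Set V} (hD : ConnectedSubset G D)
    {u x : V} (hx : x ∈ D) (hux : G.Adj u x) : ConnectedSubset G (insert u D) := by
  refine ⟨⟨u, Or.inl rfl⟩, ?_⟩
  have key : ∀ y ∈ D, ∃ p : G.Walk u y, ∀ z ∈ p.support, z ∈ Insert.insert u D := by
    intro y hy
    obtain ⟨p, hp⟩ := hD.2 x hx y hy
    refine ⟨.cons hux p, fun z hz => ?_⟩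
    rw [Walk.support_cons, List.mem_cons] at hz
    exact hz.imp id (hp z)
  rintro y (rfl | hy) z (rfl | hz)
  · exact ⟨.nil, by simp⟩
  · exact key z hz
  · obtain ⟨p, hp⟩ := key y hy
    exact ⟨p.reverse, fun t ht => hp t (by simpa using ht)⟩
  · obtain ⟨p, hp⟩ := hD.2 y hy z hz
    exact ⟨p, fun t ht => Or.inr (hp t ht)⟩

theorem ConnectedSubset.union_indPath {G : SimpleGraph V} {D : Set V}
    (hD : ConnectedSubset G D) {l : List V} (hl : IndPath G l)
    (hu : ∀ u, l.head? = some u → ∃ x ∈ D, G.Adj u x) : ConnectedSubset G (D ∪ {z | z ∈ l}) := by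
  induction l generalizing D with
  | nil => simpa using hD
  | cons u l ih =>
    obtain ⟨x, hx, hux⟩ := hu u rfl
    have := ih (hD.insert hx hux) hl.1 fun v hv =>
      ⟨u, Or.inl rfl, ((hl.2 v (List.mem_of_mem_head? hv)).2.2 hv).symm⟩
    convert this using 1
    ext z
    simp only [Set.mem_union, Set.mem_ofPred_eq, List.mem_cons, Set.mem_insert_iff]
    tauto

section StripSystem

variable {G : SimpleGraph V} {a : V} {k : ℕ} {A B C : Fin k → Set V}

theorem IsPyramidStripSystem.notMem_B (hS : IsPyramidStripSystem G a A B C) {i : Fin k} {z : V}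
    (hz : z ∈ A i ∪ C i) : z ∉ B i := by
  rcases hz with hz | hz
  · exact Set.disjoint_left.1 (hS.2.2.1 i) hz
  · exact Set.disjoint_right.1 (hS.2.1 i).2.2.2.1 hz

/-- Vertices of two different strips are distinct, and adjacent only if both lie in a `B`. -/
theorem IsPyramidStripSystem.ne_and_adj_iff (hS : IsPyramidStripSystem G a A B C) {i j : Fin k}
    (hij : i ≠ j) {p q : V} (hp : p ∈ A i ∪ B i ∪ C i) (hq : q ∈ A j ∪ B j ∪ C j) :
    p ≠ q ∧ (G.Adj p q ↔ p ∈ B i ∧ q ∈ B j) :=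
  ⟨fun h => Set.disjoint_left.1 (hS.2.2.2.1 i j hij) hp (h ▸ hq), hS.2.2.2.2.1 i j hij p hp q hq⟩

theorem IsPyramidStripSystem.ne_and_not_adj (hS : IsPyramidStripSystem G a A B C) {i j : Fin k}
    (hij : i ≠ j) {p q : V} (hp : p ∈ A i ∪ C i) (hq : q ∈ A j ∪ B j ∪ C j) :
    p ≠ q ∧ ¬ G.Adj p q := by
  have h := hS.ne_and_adj_iff hij (p := p) (q := q) (by
    rcases hp with hp | hp
    · exact Or.inl (Or.inl hp)
    · exact Or.inr hp) hq
  exact ⟨h.1, fun h' => hS.notMem_B hp (h.2.1 h').1⟩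

/-- Every vertex of a strip is on a rung; here the rung is given as the list `r ++ [b]`. -/
theorem IsPyramidStripSystem.exists_rung (hS : IsPyramidStripSystem G a A B C) {i : Fin k} {v : V}
    (hv : v ∈ A i ∪ B i ∪ C i) :
    ∃ r b, b ∈ B i ∧ (∀ z ∈ r, z ∈ A i ∪ C i) ∧ IndPath G (a :: (r ++ [b])) ∧ v ∈ r ++ [b] := by
  obtain ⟨-, hstrip, hAB, -, -, ha, haA⟩ := hS
  obtain ⟨-, -, hAC, hBC, hr⟩ := hstrip i
  obtain ⟨x, y, P, ⟨hP, hx, hy, hC, -, hind⟩, hvP⟩ := hr v hv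
  have hl := indPath_support hP hind
  have hlast : P.support.getLast? = some y := by
    rw [List.getLast?_eq_some_getLast (by simp), Walk.getLast_support]
  have hhead : P.support.head? = some x := by
    rw [List.head?_eq_some_head (by simp), Walk.head_support]
  obtain ⟨r, hr⟩ := List.getLast?_eq_some_iff.1 hlast
  rw [hr] at hl hvP hhead hC
  have hyr : ∀ z ∈ r, z ≠ y := fun z hz => ((indPath_append.1 hl).2.2 z hz y (by simp)).1
  have hmem : ∀ z ∈ r, z ∈ A i ∪ C i := by
    intro z hz
    by_cases hzx : z = x
    · exact Or.inl (hzx ▸ hx)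
    · exact Or.inr (hC z (by simp [hz]) hzx (hyr z hz))
  refine ⟨r, y, hy, hmem, ⟨hl, ?_⟩, hvP⟩
  intro z hz
  rw [hhead, Option.some_inj]
  have hzV : z ∈ A i ∪ B i ∪ C i := by
    rcases List.mem_append.1 hz with h | h
    · rcases hmem z h with h | h
      · exact Or.inl (Or.inl h)
      · exact Or.inr h
    · rw [List.mem_singleton.1 h]; exact Or.inl (Or.inr hy)
  refine ⟨fun h => ha i (h ▸ hzV), ?_⟩
  rw [haA i z hzV]
  refine ⟨fun hzA => ?_, fun h => h ▸ hx⟩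
  by_contra hne
  have hzy : z ≠ y := fun h => Set.disjoint_left.1 (hAB i) hzA (h ▸ hy)
  exact Set.disjoint_left.1 hAC hzA (hC z hz (Ne.symm hne) hzy)

/-- The induced path `l` goes from a neighbour `u` of `A i ∪ C i` to a neighbour `w` of the strip
`j`, inside `F`. -/
structure Joins (G : SimpleGraph V) (A B C : Fin k → Set V) (F : Set V) (i j : Fin k)
    (l : List V) (u w : V) : Prop where
  path : IndPath G l
  mem : ∀ z ∈ l, z ∈ F
  head : l.head? = some u
  last : l.getLast? = some w
  head_adj : ∃ x ∈ A i ∪ C i, G.Adj u x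
  last_adj : ∃ y ∈ A j ∪ B j ∪ C j, G.Adj w y

theorem Joins.eq_left {F : Set V} {i j : Fin k} {l : List V} {u w : V}
    (h : Joins G A B C F i j l u w)
    (hmin : ∀ i' j' l' u' w', i' ≠ j' → Joins G A B C F i' j' l' u' w' → l.length ≤ l'.length)
    {m : V} (hm : m ∈ l) (hmw : m ≠ w) {t : Fin k} {y : V} (hy : y ∈ A t ∪ B t ∪ C t)
    (hmy : G.Adj m y) : t = i := by
  by_contra hne
  obtain ⟨l₁, l₂, rfl⟩ := List.append_of_mem hm
  have hl₂ : l₂ ≠ [] := by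
    rintro rfl
    have := h.last
    rw [List.getLast?_concat, Option.some_inj] at this
    exact hmw this
  have hp := h.path
  have hh := h.head
  have hF := h.mem
  rw [List.append_cons] at hp hh hF
  rw [List.head?_append_of_ne_nil _ (by simp)] at hh
  have := hmin i t (l₁ ++ [m]) u m (Ne.symm hne) ⟨(indPath_append.1 hp).1,
    fun z hz => hF z (List.mem_append_left _ hz), hh, List.getLast?_concat, h.head_adj, y, hy, hmy⟩
  have h2 := List.length_pos_of_ne_nil hl₂
  simp only [List.length_append, List.length_cons, List.length_nil] at this
  omega

theorem Joins.eq_right {F : Set V} {i j : Fin k} {l : List V} {u w : V}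
    (h : Joins G A B C F i j l u w)
    (hmin : ∀ i' j' l' u' w', i' ≠ j' → Joins G A B C F i' j' l' u' w' → l.length ≤ l'.length)
    {m : V} (hm : m ∈ l) (hmu : m ≠ u) {t : Fin k} {y : V} (hy : y ∈ A t ∪ C t)
    (hmy : G.Adj m y) : t = j := by
  by_contra hne
  obtain ⟨l₁, l₂, rfl⟩ := List.append_of_mem hm
  have hl₁ : l₁ ≠ [] := by
    rintro rfl
    have := h.head
    simp only [List.nil_append, List.head?_cons, Option.some_inj] at this
    exact hmu this
  have hl := h.last
  rw [List.getLast?_append_of_ne_nil _ (by simp)] at hl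
  have := hmin t j (m :: l₂) m w hne ⟨(indPath_append.1 h.path).2.1,
    fun z hz => h.mem z (List.mem_append_right _ hz), rfl, hl, ⟨y, hy, hmy⟩, h.last_adj⟩
  have h2 := List.length_pos_of_ne_nil hl₁
  simp only [List.length_append, List.length_cons] at this
  omega

theorem Joins.exists_min {F : Set V} {i j : Fin k} {l : List V} {u w : V} (hij : i ≠ j)
    (h : Joins G A B C F i j l u w) : ∃ i j l u w, i ≠ j ∧ Joins G A B C F i j l u w ∧
      ∀ i' j' l' u' w', i' ≠ j' → Joins G A B C F i' j' l' u' w' → l.length ≤ l'.length := by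
  classical
  have hex : ∃ n, ∃ i j l u w, i ≠ j ∧ Joins G A B C F i j l u w ∧ l.length = n :=
    ⟨_, i, j, l, u, w, hij, h, rfl⟩
  obtain ⟨i, j, l, u, w, hij, h, hl⟩ := Nat.find_spec hex
  refine ⟨i, j, l, u, w, hij, h, fun i' j' l' u' w' hij' h' => ?_⟩
  rw [hl]
  exact Nat.find_min' hex ⟨i', j', l', u', w', hij', h', rfl⟩

theorem Joins.symm {F : Set V} {i j : Fin k} {l : List V} {u w : V}
    (h : Joins G A B C F i j l u w) (hw : ∃ y ∈ A j ∪ C j, G.Adj w y) :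
    Joins G A B C F j i l.reverse w u where
  path := h.path.reverse
  mem z hz := h.mem z (List.mem_reverse.1 hz)
  head := by rw [List.head?_reverse, h.last]
  last := by rw [List.getLast?_reverse, h.head]
  head_adj := hw
  last_adj := by
    obtain ⟨x, hx, hux⟩ := h.head_adj
    exact ⟨x, hx.elim (fun h => Or.inl (Or.inl h)) Or.inr, hux⟩

theorem IsPyramidStripSystem.false_of_adj_three (hS : IsPyramidStripSystem G a A B C)
    (hG : EvenHoleFree G) {u : V} (hua : u ≠ a) (hau : ¬ G.Adj a u)
    (huV : ∀ i, u ∉ A i ∪ B i ∪ C i) {i j t : Fin k} (hij : i ≠ j) (hit : i ≠ t) (hjt : j ≠ t)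
    (hi : ∃ x ∈ A i ∪ C i, G.Adj u x) (hj : ∃ x ∈ A j ∪ C j, G.Adj u x)
    (ht : ∃ x ∈ A t ∪ B t ∪ C t, G.Adj u x) : False := by
  have hAC : ∀ (i : Fin k) (z : V), z ∈ A i ∪ C i → z ∈ A i ∪ B i ∪ C i := fun i z hz =>
    hz.elim (fun h => Or.inl (Or.inl h)) Or.inr
  have hpath : ∀ (i : Fin k) (R : List V), IndPath G (a :: R) →
      (∀ z ∈ R, z ∈ A i ∪ B i ∪ C i) → (∃ x ∈ R, G.Adj u x) →
      ∃ L, (∀ z ∈ L, z ∈ R) ∧ IndPath G (a :: (L ++ [u])) := by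
    intro i R hR hRi hx
    obtain ⟨L, -, hL, hp⟩ := hR.exists_append (P := [u]) indPath_singleton rfl (by simp [hua, hau])
      (by
        intro m hm z hz
        obtain rfl := List.mem_singleton.1 hm
        exact ⟨fun h => huV i (h ▸ hRi z hz), fun _ => rfl⟩) hx
    exact ⟨L, hL, hp⟩
  have hAC' : ∀ i, (∃ x ∈ A i ∪ C i, G.Adj u x) →
      ∃ L, (∀ z ∈ L, z ∈ A i ∪ C i) ∧ IndPath G (a :: (L ++ [u])) := by
    rintro i ⟨x, hx, hux⟩
    obtain ⟨r, b, hb, hr, hp, hxr⟩ := hS.exists_rung (hAC i x hx)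
    have hxr' : x ∈ r := by
      rcases List.mem_append.1 hxr with h | h
      · exact h
      · exact absurd (List.mem_singleton.1 h ▸ hb) (hS.notMem_B hx)
    rw [← List.cons_append] at hp
    obtain ⟨L, hL, hLp⟩ := hpath i r (indPath_append.1 hp).1 (fun z hz => hAC i z (hr z hz))
      ⟨x, hxr', hux⟩
    exact ⟨L, fun z hz => hr z (hL z hz), hLp⟩
  obtain ⟨L₁, h₁, hL₁⟩ := hAC' i hi
  obtain ⟨L₂, h₂, hL₂⟩ := hAC' j hj
  obtain ⟨L₃, h₃, hL₃⟩ : ∃ L, (∀ z ∈ L, z ∈ A t ∪ B t ∪ C t) ∧ IndPath G (a :: (L ++ [u])) := by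
    obtain ⟨x, hx, hux⟩ := ht
    obtain ⟨r, b, hb, hr, hp, hxr⟩ := hS.exists_rung hx
    have hrV : ∀ z ∈ r ++ [b], z ∈ A t ∪ B t ∪ C t := by
      intro z hz
      rcases List.mem_append.1 hz with h | h
      · exact hAC t z (hr z h)
      · exact Or.inl (Or.inr (List.mem_singleton.1 h ▸ hb))
    obtain ⟨L, hL, hLp⟩ := hpath t _ hp hrV ⟨x, hxr, hux⟩
    exact ⟨L, fun z hz => hrV z (hL z hz), hLp⟩
  exact hG.no_theta hau hL₁ hL₂ hL₃
    (fun x hx y hy => hS.ne_and_not_adj hij (h₁ x hx) (hAC j y (h₂ y hy)))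
    (fun x hx y hy => hS.ne_and_not_adj hit (h₁ x hx) (h₃ y hy))
    (fun x hx y hy => hS.ne_and_not_adj hjt (h₂ x hx) (h₃ y hy))

theorem IsPyramidStripSystem.exists_third (hS : IsPyramidStripSystem G a A B C) (i j : Fin k) :
    ∃ t, t ≠ i ∧ t ≠ j := by
  have hk := hS.1
  by_contra! h
  have : (Finset.univ : Finset (Fin k)) ⊆ {i, j} := by
    intro t _
    by_cases ht : t = i
    · simp [ht]
    · simp [h t ht]
  have := (Finset.card_le_card this).trans Finset.card_le_two
  simp at this
  omega

/-- A minimal path joining the sets `A i ∪ C i` and `A j ∪ C j` of two strips forces an extended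
near-prism. -/
theorem IsPyramidStripSystem.extNearPrismCrossEnd (hS : IsPyramidStripSystem G a A B C)
    (hG : EvenHoleFree G) {F : Set V} (hFa : ∀ m ∈ F, m ≠ a ∧ ¬ G.Adj a m)
    (hFV : ∀ m ∈ F, ∀ i, m ∉ A i ∪ B i ∪ C i) {i j : Fin k} (hij : i ≠ j) {P : List V} {u w : V}
    (h : Joins G A B C F i j P u w)
    (hmin : ∀ i' j' l' u' w', i' ≠ j' → Joins G A B C F i' j' l' u' w' → P.length ≤ l'.length)
    (hw : ∃ y ∈ A j ∪ C j, G.Adj w y) : ExtNearPrismCrossEnd G a := by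
  have hAC : ∀ (i : Fin k) (z : V), z ∈ A i ∪ C i → z ∈ A i ∪ B i ∪ C i := fun i z hz =>
    hz.elim (fun h => Or.inl (Or.inl h)) Or.inr
  have huP : u ∈ P := List.mem_of_mem_head? h.head
  have hwP : w ∈ P := List.mem_of_getLast? h.last
  have hL : ∀ m ∈ P, m ≠ w → ∀ t, ∀ y ∈ A t ∪ B t ∪ C t, G.Adj m y → t = i :=
    fun m hm hmw t y hy hmy => h.eq_left hmin hm hmw hy hmy
  have hR : ∀ m ∈ P, m ≠ u → ∀ t, ∀ y ∈ A t ∪ B t ∪ C t, G.Adj m y → t = j :=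
    fun m hm hmu t y hy hmy => (h.symm hw).eq_left (fun i' j' l' u' w' hij' h' => by
      rw [List.length_reverse]; exact hmin i' j' l' u' w' hij' h') (List.mem_reverse.2 hm) hmu hy hmy
  obtain ⟨t, hti, htj⟩ := hS.exists_third i j
  by_cases h3 : ∃ z ∈ A t ∪ B t ∪ C t, ∃ m ∈ P, G.Adj m z
  · obtain ⟨z, hz, m, hm, hmz⟩ := h3
    obtain rfl : m = w := by
      by_contra hne
      exact hti (hL m hm hne t z hz hmz)
    obtain rfl : m = u := by
      by_contra hne
      exact htj (hR m hm hne t z hz hmz)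
    exact (hS.false_of_adj_three hG (hFa m (h.mem m hm)).1 (hFa m (h.mem m hm)).2
      (hFV m (h.mem m hm)) hij hti.symm htj.symm h.head_adj hw ⟨z, hz, hmz⟩).elim
  · push Not at h3
    obtain ⟨x, hx, hux⟩ := h.head_adj
    obtain ⟨y, hy, hwy⟩ := hw
    have hrung : ∀ i, ∀ x ∈ A i ∪ B i ∪ C i, ∃ R b, b ∈ B i ∧ (∀ z ∈ R, z ∈ A i ∪ B i ∪ C i) ∧
        (∀ z ∈ R, z ∈ B i ↔ z = b) ∧ IndPath G (a :: R) ∧ R.getLast? = some b ∧ x ∈ R := by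
      intro i x hx
      obtain ⟨r, b, hb, hr, hp, hxr⟩ := hS.exists_rung hx
      refine ⟨r ++ [b], b, hb, ?_, ?_, hp, List.getLast?_concat, hxr⟩
      · intro z hz
        rcases List.mem_append.1 hz with h | h
        · exact hAC i z (hr z h)
        · exact Or.inl (Or.inr (List.mem_singleton.1 h ▸ hb))
      · intro z hz
        refine ⟨fun hzb => ?_, fun hzb => hzb ▸ hb⟩
        rcases List.mem_append.1 hz with h | h
        · exact absurd hzb (hS.notMem_B (hr z h))
        · exact List.mem_singleton.1 h
    obtain ⟨R₁, b₁, hb₁, hV₁, hB₁, hp₁, hl₁, hx₁⟩ := hrung i x (hAC i x hx)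
    obtain ⟨R₂, b₂, hb₂, hV₂, hB₂, hp₂, hl₂, hy₂⟩ := hrung j y (hAC j y hy)
    obtain ⟨z, hz⟩ := (hS.2.1 t).1
    obtain ⟨R₃, b₃, hb₃, hV₃, hB₃, hp₃, hl₃, -⟩ := hrung t z (Or.inl (Or.inl hz))
    refine LinkedPyramid.extNearPrismCrossEnd_of_evenHoleFree (R₁ := R₁) (R₂ := R₂) (R₃ := R₃) (P := P) (b₁ := b₁)
      (b₂ := b₂) (b₃ := b₃) (u := u) (w := w) ?_ hG
    exact {
      path₁ := hp₁, path₂ := hp₂, path₃ := hp₃, last₁ := hl₁, last₂ := hl₂, last₃ := hl₃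
      path := h.path, head := h.head, last := h.last
      apex := fun m hm => hFa m (h.mem m hm)
      sep₁₂ := fun p hp q hq => by
        rw [← hB₁ p hp, ← hB₂ q hq]
        exact hS.ne_and_adj_iff hij (hV₁ p hp) (hV₂ q hq)
      sep₁₃ := fun p hp q hq => by
        rw [← hB₁ p hp, ← hB₃ q hq]
        exact hS.ne_and_adj_iff hti.symm (hV₁ p hp) (hV₃ q hq)
      sep₂₃ := fun p hp q hq => by
        rw [← hB₂ p hp, ← hB₃ q hq]
        exact hS.ne_and_adj_iff htj.symm (hV₂ p hp) (hV₃ q hq)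
      link₁ := fun m hm p hp => ⟨fun h' => hFV m (h.mem m hm) i (h' ▸ hV₁ p hp), fun hmp => by
        by_contra hne
        exact hij (hR m hm hne i p (hV₁ p hp) hmp)⟩
      link₂ := fun m hm p hp => ⟨fun h' => hFV m (h.mem m hm) j (h' ▸ hV₂ p hp), fun hmp => by
        by_contra hne
        exact hij (hL m hm hne j p (hV₂ p hp) hmp).symm⟩
      link₃ := fun m hm p hp => ⟨fun h' => hFV m (h.mem m hm) t (h' ▸ hV₃ p hp),
        h3 p (hV₃ p hp) m hm⟩
      head_adj := ⟨x, hx₁, fun h' => hS.notMem_B hx (h' ▸ hb₁), hux⟩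
      last_adj := ⟨y, hy₂, fun h' => hS.notMem_B hy (h' ▸ hb₂), hwy⟩ }

/-- Replacing one strip of a pyramid strip system by a larger one. -/
theorem IsPyramidStripSystem.update (hS : IsPyramidStripSystem G a A B C) {i : Fin k}
    {B' C' : Set V} (hstrip : IsStrip G (A i) B' C') (hAB : Disjoint (A i) B')
    (hsep : ∀ p ∈ A i ∪ B' ∪ C', ∀ j, j ≠ i → ∀ q ∈ A j ∪ B j ∪ C j,
      p ≠ q ∧ (G.Adj p q ↔ p ∈ B' ∧ q ∈ B j))
    (ha : ∀ p ∈ A i ∪ B' ∪ C', p ≠ a ∧ (G.Adj a p ↔ p ∈ A i)) :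
    IsPyramidStripSystem G a A (Function.update B i B') (Function.update C i C') := by
  refine ⟨hS.1, ?_, ?_, ?_, ?_, ?_, ?_⟩
  · intro t
    rcases eq_or_ne t i with rfl | ht
    · simpa using hstrip
    · simpa [ht] using hS.2.1 t
  · intro t
    rcases eq_or_ne t i with rfl | ht
    · simpa using hAB
    · simpa [ht] using hS.2.2.1 t
  · intro s t hst
    rw [Set.disjoint_left]
    intro p hp hq
    rcases eq_or_ne s i with rfl | hs
    · rw [Function.update_self, Function.update_self] at hp
      rw [Function.update_of_ne hst.symm, Function.update_of_ne hst.symm] at hq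
      exact (hsep p hp t hst.symm p hq).1 rfl
    · rw [Function.update_of_ne hs, Function.update_of_ne hs] at hp
      rcases eq_or_ne t i with rfl | ht
      · rw [Function.update_self, Function.update_self] at hq
        exact (hsep p hq s hs p hp).1 rfl
      · rw [Function.update_of_ne ht, Function.update_of_ne ht] at hq
        exact Set.disjoint_left.1 (hS.2.2.2.1 s t hst) hp hq
  · intro s t hst p hp q hq
    rcases eq_or_ne s i with rfl | hs
    · rw [Function.update_self, Function.update_self] at hp
      rw [Function.update_of_ne hst.symm, Function.update_of_ne hst.symm] at hq
      rw [Function.update_self, Function.update_of_ne hst.symm]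
      exact (hsep p hp t hst.symm q hq).2
    · rw [Function.update_of_ne hs, Function.update_of_ne hs] at hp
      rcases eq_or_ne t i with rfl | ht
      · rw [Function.update_self, Function.update_self] at hq
        rw [Function.update_self, Function.update_of_ne hs, G.adj_comm, and_comm]
        exact (hsep q hq s hs p hp).2
      · rw [Function.update_of_ne ht, Function.update_of_ne ht] at hq
        rw [Function.update_of_ne hs, Function.update_of_ne ht]
        exact hS.2.2.2.2.1 s t hst p hp q hq
  · intro t
    rcases eq_or_ne t i with rfl | ht
    · rw [Function.update_self, Function.update_self]
      exact fun h => (ha a h).1 rfl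
    · rw [Function.update_of_ne ht, Function.update_of_ne ht]
      exact hS.2.2.2.2.2.1 t
  · intro t p hp
    rcases eq_or_ne t i with rfl | ht
    · rw [Function.update_self, Function.update_self] at hp
      exact (ha p hp).2
    · rw [Function.update_of_ne ht, Function.update_of_ne ht] at hp
      exact hS.2.2.2.2.2.2 t p hp

/-- A path that attaches only to the strip `i`, except that its last vertex is complete to the sets
`B j` with `j ≠ i`, can be added to the strip `i`. -/
theorem IsPyramidStripSystem.extend (hS : IsPyramidStripSystem G a A B C) {F : Set V}
    (hFa : ∀ m ∈ F, m ≠ a ∧ ¬ G.Adj a m) (hFV : ∀ m ∈ F, ∀ i, m ∉ A i ∪ B i ∪ C i)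
    {i j : Fin k} {P : List V} {u w : V} (h : Joins G A B C F i j P u w)
    (hL : ∀ m ∈ P, m ≠ w → ∀ t, ∀ y ∈ A t ∪ B t ∪ C t, G.Adj m y → t = i)
    (hR : ∀ m ∈ P, m ≠ u → ∀ t, ∀ y ∈ A t ∪ C t, ¬ G.Adj m y)
    (hw : ∀ t, t ≠ i → ∀ y ∈ A t ∪ B t ∪ C t, (G.Adj w y ↔ y ∈ B t)) :
    IsPyramidStripSystem G a A (Function.update B i (insert w (B i)))
      (Function.update C i (C i ∪ {z | z ∈ P ∧ z ≠ w})) := by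
  have huP : u ∈ P := List.mem_of_mem_head? h.head
  have hwP : w ∈ P := List.mem_of_getLast? h.last
  have hPV := fun m hm => hFV m (h.mem m hm)
  have hV : ∀ p ∈ A i ∪ insert w (B i) ∪ (C i ∪ {z | z ∈ P ∧ z ≠ w}),
      p ∈ A i ∪ B i ∪ C i ∨ p ∈ P := by
    rintro p ((hp | rfl | hp) | hp | hp)
    · exact Or.inl (Or.inl (Or.inl hp))
    · exact Or.inr hwP
    · exact Or.inl (Or.inl (Or.inr hp))
    · exact Or.inl (Or.inr hp)
    · exact Or.inr hp.1
  have hAC : ∀ (i : Fin k) (z : V), z ∈ A i ∪ C i → z ∈ A i ∪ B i ∪ C i := fun i z hz =>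
    hz.elim (fun h => Or.inl (Or.inl h)) Or.inr
  have hmB : ∀ p ∈ A i ∪ B i ∪ C i, p ∈ insert w (B i) ↔ p ∈ B i := fun p hp =>
    ⟨fun h' => h'.elim (fun h' => absurd (h' ▸ hp) (hPV w hwP i)) id, Or.inr⟩
  have hAB : Disjoint (A i) (insert w (B i)) := by
    rw [Set.disjoint_left]
    intro z hz hz'
    exact Set.disjoint_left.1 (hS.2.2.1 i) hz ((hmB z (Or.inl (Or.inl hz))).1 hz')
  obtain ⟨hA0, -, hdAC, hdBC, hrung⟩ := hS.2.1 i
  refine hS.update ⟨hA0, ⟨w, Or.inl rfl⟩, ?_, ?_, ?_⟩ hAB ?_ ?_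
  · rw [Set.disjoint_left]
    rintro z hz (hz' | hz')
    · exact Set.disjoint_left.1 hdAC hz hz'
    · exact hPV z hz'.1 i (Or.inl (Or.inl hz))
  · rw [Set.disjoint_left]
    rintro z (rfl | hz) (hz' | hz')
    · exact hPV z hwP i (Or.inr hz')
    · exact hz'.2 rfl
    · exact Set.disjoint_left.1 hdBC hz hz'
    · exact hPV z hz'.1 i (Or.inl (Or.inr hz))
  · intro v hv
    rcases hV v hv with hv | hv
    · obtain ⟨x, y, Q, ⟨hQ, hx, hy, hC, hxy, hind⟩, hvQ⟩ := hrung v (by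
        rcases hv with (hv | hv) | hv
        · exact Or.inl (Or.inl hv)
        · exact Or.inl (Or.inr hv)
        · exact Or.inr hv)
      refine ⟨x, y, Q, ⟨hQ, hx, Or.inr hy, fun z hz hzx hzy => Or.inl (hC z hz hzx hzy),
        fun hne => ⟨?_, (hxy hne).2⟩, hind⟩, hvQ⟩
      exact Set.disjoint_left.1 hAB hx
    · obtain ⟨x, hx, hux⟩ := h.head_adj
      obtain ⟨r, b, hb, hr, hp, hxr⟩ := hS.exists_rung (hAC i x hx)
      have hxr' : x ∈ r := by
        rcases List.mem_append.1 hxr with h | h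
        · exact h
        · exact absurd (List.mem_singleton.1 h ▸ hb) (hS.notMem_B hx)
      rw [← List.cons_append] at hp
      obtain ⟨L, hL0, hLr, hLp⟩ := (indPath_append.1 hp).1.exists_append h.path h.head
        (fun m hm => hFa m (h.mem m hm)) (fun m hm z hz =>
          ⟨fun h' => hPV m hm i (h' ▸ hAC i z (hr z hz)), fun hmz => by
            by_contra hne
            exact hR m hm hne i z (hr z hz) hmz⟩) ⟨x, hxr', hux⟩
      obtain ⟨s, L, rfl⟩ := List.exists_cons_of_ne_nil hL0
      obtain ⟨Q, hQ, hQp, hQi⟩ := hLp.1.exists_walk (u := s) (v := w) rfl (by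
        rw [List.getLast?_append_of_ne_nil _ (List.ne_nil_of_mem huP), h.last])
      have has : G.Adj a s := (hLp.2 s (by simp)).2.2 rfl
      have hsV : s ∈ A i ∪ C i := hr s (hLr s (by simp))
      have hsA : s ∈ A i := (hS.2.2.2.2.2.2 i s (hAC i s hsV)).1 has
      refine ⟨s, w, Q, ⟨hQp, hsA, Or.inl rfl, ?_, fun _ => ⟨Set.disjoint_left.1 hAB hsA,
        fun hwA => hPV w hwP i (Or.inl (Or.inl hwA))⟩, hQi⟩, ?_⟩
      · intro z hz hzs hzw
        rw [hQ, List.mem_append] at hz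
        rcases hz with hz | hz
        · refine Or.inl ((hr z (hLr z hz)).resolve_left fun hzA => hzs ?_)
          have := (hLp.2 z (List.mem_append_left _ hz)).2.1
            ((hS.2.2.2.2.2.2 i z (Or.inl (Or.inl hzA))).2 hzA)
          rw [List.cons_append, List.head?_cons, Option.some_inj] at this
          exact this.symm
        · exact Or.inr ⟨hz, hzw⟩
      · rw [hQ]
        exact List.mem_append_right _ hv
  · intro p hp t ht q hq
    rcases hV p hp with hp | hp
    · rw [hmB p hp]
      exact hS.ne_and_adj_iff ht.symm hp hq
    · refine ⟨fun h' => hPV p hp t (h' ▸ hq), ?_⟩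
      rcases eq_or_ne p w with rfl | hpw
      · rw [hw t ht q hq]
        simp
      · refine ⟨fun hpq => absurd (hL p hp hpw t q hq hpq) ht, ?_⟩
        rintro ⟨h' | h', -⟩
        · exact absurd h' hpw
        · exact absurd (Or.inl (Or.inr h')) (hPV p hp i)
  · intro p hp
    rcases hV p hp with hp | hp
    · exact ⟨fun h' => hS.2.2.2.2.2.1 i (h' ▸ hp), hS.2.2.2.2.2.2 i p hp⟩
    · have := hFa p (h.mem p hp)
      exact ⟨this.1, fun h' => absurd h' this.2, fun h' => absurd (Or.inl (Or.inl h')) (hPV p hp i)⟩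

/-- If the last vertex of the path has both a neighbour and a non-neighbour in the sets `B t` of
two strips different from `i`, there is a theta. -/
theorem IsPyramidStripSystem.false_of_adj_not_adj (hS : IsPyramidStripSystem G a A B C)
    (hG : EvenHoleFree G) {F : Set V}
    (hFa : ∀ m ∈ F, m ≠ a ∧ ¬ G.Adj a m) (hFV : ∀ m ∈ F, ∀ i, m ∉ A i ∪ B i ∪ C i)
    {i j : Fin k} {P : List V} {u w : V} (h : Joins G A B C F i j P u w)
    (hL : ∀ m ∈ P, m ≠ w → ∀ t, ∀ y ∈ A t ∪ B t ∪ C t, G.Adj m y → t = i)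
    (hR : ∀ m ∈ P, m ≠ u → ∀ t, ∀ y ∈ A t ∪ C t, ¬ G.Adj m y)
    (hw : ∀ t, t ≠ i → ∀ y ∈ A t ∪ C t, ¬ G.Adj w y) {s t : Fin k} (hsi : s ≠ i) (hti : t ≠ i)
    (hst : s ≠ t) {b b' : V} (hb : b ∈ B s) (hb' : b' ∈ B t) (hwb : G.Adj w b)
    (hwb' : ¬ G.Adj w b') : False := by
  have huP : u ∈ P := List.mem_of_mem_head? h.head
  have hwP : w ∈ P := List.mem_of_getLast? h.last
  have hPV := fun m hm => hFV m (h.mem m hm)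
  have hAC : ∀ (i : Fin k) (z : V), z ∈ A i ∪ C i → z ∈ A i ∪ B i ∪ C i := fun i z hz =>
    hz.elim (fun h => Or.inl (Or.inl h)) Or.inr
  have hbV : b ∈ A s ∪ B s ∪ C s := Or.inl (Or.inr hb)
  have hbV' : b' ∈ A t ∪ B t ∪ C t := Or.inl (Or.inr hb')
  have hrung : ∀ t, ∀ b ∈ B t, ∃ r, (∀ z ∈ r, z ∈ A t ∪ C t) ∧ IndPath G (a :: (r ++ [b])) := by
    intro t b hb
    obtain ⟨r, c, hc, hr, hp, hbr⟩ := hS.exists_rung (i := t) (v := b) (Or.inl (Or.inr hb))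
    rcases List.mem_append.1 hbr with h | h
    · exact absurd hb (hS.notMem_B (hr b h))
    · rw [List.mem_singleton.1 h]
      exact ⟨r, hr, hp⟩
  have hPt : ∀ t, t ≠ i → ∀ m ∈ P, ∀ y ∈ A t ∪ C t, m ≠ y ∧ ¬ G.Adj m y := by
    intro t ht m hm y hy
    refine ⟨fun h' => hPV m hm t (h' ▸ hAC t y hy), fun hmy => ?_⟩
    by_cases hmw : m = w
    · exact hw t ht y hy (hmw ▸ hmy)
    · exact ht (hL m hm hmw t y (hAC t y hy) hmy)
  obtain ⟨r₁, hr₁, hp₁⟩ := hrung s b hb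
  obtain ⟨r₂, hr₂, hp₂⟩ := hrung t b' hb'
  obtain ⟨x, hx, hux⟩ := h.head_adj
  obtain ⟨r, c, hc, hr, hp, hxr⟩ := hS.exists_rung (hAC i x hx)
  have hxr' : x ∈ r := by
    rcases List.mem_append.1 hxr with h | h
    · exact h
    · exact absurd (List.mem_singleton.1 h ▸ hc) (hS.notMem_B hx)
  rw [← List.cons_append] at hp
  obtain ⟨L, hL0, hLr, hLp⟩ := (indPath_append.1 hp).1.exists_append h.path h.head
    (fun m hm => hFa m (h.mem m hm)) (fun m hm z hz =>
      ⟨fun h' => hPV m hm i (h' ▸ hAC i z (hr z hz)), fun hmz => by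
        by_contra hne
        exact hR m hm hne i z (hr z hz) hmz⟩) ⟨x, hxr', hux⟩
  have hab : a ≠ b ∧ ¬ G.Adj a b := by
    refine ⟨fun h' => hS.2.2.2.2.2.1 s (h' ▸ hbV), ?_⟩
    rw [hS.2.2.2.2.2.2 s b hbV]
    exact Set.disjoint_right.1 (hS.2.2.1 s) hb
  have hbb' := (hS.ne_and_adj_iff hst hbV hbV').2.2 ⟨hb, hb'⟩
  refine hG.no_theta (a := a) (w := b) (L₁ := r₁) (L₂ := r₂ ++ [b']) (L₃ := L ++ P) hab.2 hp₁
    ?_ ?_ ?_ ?_ ?_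
  · rw [← List.cons_append]
    refine hp₂.append (u := b') (v := b) indPath_singleton ?_ rfl hbb'.symm ?_
    · rw [← List.cons_append, List.getLast?_concat]
    · intro z hz y hy
      obtain rfl := List.mem_singleton.1 hy
      rcases List.mem_cons.1 hz with rfl | hz
      · exact ⟨hab.1, fun h' => absurd h' hab.2⟩
      rcases List.mem_append.1 hz with hz | hz
      · have := hS.ne_and_not_adj hst.symm (hr₂ z hz) hbV
        exact ⟨this.1, fun h' => absurd h' this.2⟩
      · obtain rfl := List.mem_singleton.1 hz
        exact ⟨hbb'.ne.symm, fun _ => ⟨rfl, rfl⟩⟩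
  · rw [← List.cons_append]
    refine hLp.append (u := w) (v := b) indPath_singleton ?_ rfl hwb ?_
    · rw [← List.cons_append, List.getLast?_append_of_ne_nil _ (List.ne_nil_of_mem huP), h.last]
    · intro z hz y hy
      obtain rfl := List.mem_singleton.1 hy
      rcases List.mem_cons.1 hz with rfl | hz
      · exact ⟨hab.1, fun h' => absurd h' hab.2⟩
      rcases List.mem_append.1 hz with hz | hz
      · have := hS.ne_and_not_adj hsi.symm (hr z (hLr z hz)) hbV
        exact ⟨this.1, fun h' => absurd h' this.2⟩
      · refine ⟨fun h' => hPV z hz s (h' ▸ hbV), fun hzb => ⟨?_, rfl⟩⟩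
        by_contra hne
        exact hsi (hL z hz hne s y hbV hzb)
  · intro z hz y hy
    refine hS.ne_and_not_adj hst (hr₁ z hz) ?_
    rcases List.mem_append.1 hy with hy | hy
    · exact hAC t y (hr₂ y hy)
    · exact List.mem_singleton.1 hy ▸ hbV'
  · intro z hz y hy
    rcases List.mem_append.1 hy with hy | hy
    · exact hS.ne_and_not_adj hsi (hr₁ z hz) (hAC i y (hr y (hLr y hy)))
    · have := hPt s hsi y hy z (hr₁ z hz)
      exact ⟨this.1.symm, fun h' => this.2 h'.symm⟩
  · intro z hz y hy
    rcases List.mem_append.1 hy with hy | hy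
    · have := hS.ne_and_not_adj hti.symm (hr y (hLr y hy)) (q := z) (by
        rcases List.mem_append.1 hz with hz | hz
        · exact hAC t z (hr₂ z hz)
        · exact List.mem_singleton.1 hz ▸ hbV')
      exact ⟨this.1.symm, fun h' => this.2 h'.symm⟩
    · rcases List.mem_append.1 hz with hz | hz
      · have := hPt t hti y hy z (hr₂ z hz)
        exact ⟨this.1.symm, fun h' => this.2 h'.symm⟩
      · obtain rfl := List.mem_singleton.1 hz
        refine ⟨fun h' => hPV y hy t (h' ▸ hbV'), fun hzy => ?_⟩
        by_cases hyw : y = w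
        · exact hwb' (hyw ▸ hzy.symm)
        · exact hti (hL y hy hyw t z hbV' hzy.symm)

/-- In a maximal indecomposable pyramid strip system, no set `F` of vertices outside joins
`A i ∪ C i` to a strip different from `i`. -/
theorem IsPyramidStripSystem.not_joins (hS : IsPyramidStripSystem G a A B C)
    (hG : EvenHoleFree G) (hnx : ¬ ExtNearPrismCrossEnd G a)
    (hidc : ∀ i, ConnectedSubset G (A i ∪ C i))
    (hmax : ∀ (k' : ℕ) (A' B' C' : Fin k' → Set V),
      IsPyramidStripSystem G a A' B' C' →
      (∀ i, ConnectedSubset G (A' i ∪ C' i)) →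
      PSSVerts a A B C ⊆ PSSVerts a A' B' C' →
      PSSVerts a A' B' C' = PSSVerts a A B C)
    {F : Set V} (hFa : ∀ m ∈ F, m ≠ a ∧ ¬ G.Adj a m)
    (hFV : ∀ m ∈ F, ∀ i, m ∉ A i ∪ B i ∪ C i) {i j : Fin k} (hij : i ≠ j) {P : List V} {u w : V} :
    ¬ Joins G A B C F i j P u w := by
  intro h'
  obtain ⟨i, j, P, u, w, hij, h, hmin⟩ := h'.exists_min hij
  have huP : u ∈ P := List.mem_of_mem_head? h.head
  have hwP : w ∈ P := List.mem_of_getLast? h.last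
  have hAC : ∀ (i : Fin k) (z : V), z ∈ A i ∪ C i → z ∈ A i ∪ B i ∪ C i := fun i z hz =>
    hz.elim (fun h => Or.inl (Or.inl h)) Or.inr
  have hL : ∀ m ∈ P, m ≠ w → ∀ t, ∀ y ∈ A t ∪ B t ∪ C t, G.Adj m y → t = i :=
    fun m hm hmw t y hy hmy => h.eq_left hmin hm hmw hy hmy
  by_cases hw : ∃ t, t ≠ i ∧ ∃ y ∈ A t ∪ C t, G.Adj w y
  · obtain ⟨t, hti, y, hy, hwy⟩ := hw
    exact hnx (hS.extNearPrismCrossEnd hG hFa hFV hti.symm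
      ⟨h.path, h.mem, h.head, h.last, h.head_adj, y, hAC t y hy, hwy⟩ hmin ⟨y, hy, hwy⟩)
  · push Not at hw
    have hR : ∀ m ∈ P, m ≠ u → ∀ t, ∀ y ∈ A t ∪ C t, ¬ G.Adj m y := by
      intro m hm hmu t y hy hmy
      obtain rfl := h.eq_right hmin hm hmu hy hmy
      by_cases hmw : m = w
      · exact hw t hij.symm y hy (hmw ▸ hmy)
      · exact hij (hL m hm hmw t y (hAC t y hy) hmy).symm
    by_cases hcompl : ∀ t, t ≠ i → ∀ y ∈ B t, G.Adj w y
    · have hS' := hS.extend hFa hFV h hL hR (by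
        intro t ht y hy
        refine ⟨fun hwy => ?_, hcompl t ht y⟩
        by_contra hyB
        refine hw t ht y ?_ hwy
        rcases hy with (hy | hy) | hy
        · exact Or.inl hy
        · exact absurd hy hyB
        · exact Or.inr hy)
      have hwV : w ∉ PSSVerts a A B C := by
        rintro (h1 | h1)
        · exact (hFa w (h.mem w hwP)).1 h1
        · obtain ⟨t, ht⟩ := Set.mem_iUnion.1 h1
          exact hFV w (h.mem w hwP) t ht
      refine hwV ?_
      rw [← hmax _ _ _ _ hS' ?_ ?_]
      · refine Or.inr (Set.mem_iUnion.2 ⟨i, ?_⟩)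
        rw [Function.update_self]
        exact Or.inl (Or.inr (Or.inl rfl))
      · intro t
        rcases eq_or_ne t i with rfl | ht
        · rw [Function.update_self, ← Set.union_assoc]
          obtain ⟨P', hP'⟩ := List.getLast?_eq_some_iff.1 h.last
          have hp := h.path
          rw [hP', indPath_append] at hp
          have : {z | z ∈ P ∧ z ≠ w} = {z | z ∈ P'} := by
            ext z
            have h1 := fun hz => (hp.2.2 z hz w (by simp)).1
            simp only [hP', Set.mem_ofPred_eq, List.mem_append, List.mem_singleton]
            tauto
          rw [this]
          refine (hidc t).union_indPath hp.1 fun z hz => ?_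
          have hh := h.head
          rw [hP', List.head?_append_of_ne_nil _ (List.ne_nil_of_mem (List.mem_of_mem_head? hz)),
            hz, Option.some_inj] at hh
          rw [hh]
          exact h.head_adj
        · rw [Function.update_of_ne ht]
          exact hidc t
      · refine Set.insert_subset_insert (Set.iUnion_mono fun t => ?_)
        rcases eq_or_ne t i with rfl | ht
        · rw [Function.update_self, Function.update_self]
          exact Set.union_subset_union (Set.union_subset_union_right _ (Set.subset_insert _ _))
            Set.subset_union_left
        · rw [Function.update_of_ne ht, Function.update_of_ne ht]
    · push Not at hcompl
      obtain ⟨t, hti, b', hb', hwb'⟩ := hcompl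
      obtain ⟨b, hb, hwb⟩ : ∃ b ∈ B j, G.Adj w b := by
        obtain ⟨y, (hy | hy) | hy, hwy⟩ := h.last_adj
        · exact absurd hwy (hw j hij.symm y (Or.inl hy))
        · exact ⟨y, hy, hwy⟩
        · exact absurd hwy (hw j hij.symm y (Or.inr hy))
      rcases eq_or_ne j t with rfl | hjt
      · obtain ⟨s, hsi, hsj⟩ := hS.exists_third i j
        obtain ⟨c, hc⟩ := (hS.2.1 s).2.1
        by_cases hwc : G.Adj w c
        · exact hS.false_of_adj_not_adj hG hFa hFV h hL hR hw hsi hti hsj hc hb' hwc hwb'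
        · exact hS.false_of_adj_not_adj hG hFa hFV h hL hR hw hti hsi hsj.symm hb hc hwb hwc
      · exact hS.false_of_adj_not_adj hG hFa hFV h hL hR hw hij.symm hti hjt hb hb' hwb hwb'

/-- A component of the part of `G` outside the system and `N[a]` has a neighbour in the system that
is not a neighbour of `a`. -/
theorem IsPyramidStripSystem.exists_mem_att (hS : IsPyramidStripSystem G a A B C)
    (ha : ConnectedSubset G (closedNbhd G a)ᶜ) {F : Set V}
    (hF : IsComponentOf G (PSSVerts a A B C ∪ closedNbhd G a) F) :
    ∃ i, ∃ y ∈ B i ∪ C i, y ∈ Att G (PSSVerts a A B C) F := by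
  obtain ⟨⟨⟨f, hf⟩, -⟩, hdisj, hcl⟩ := hF
  have hi : 0 < k := by have := hS.1; omega
  obtain ⟨b, hb⟩ := (hS.2.1 ⟨0, hi⟩).2.1
  have hbV : b ∈ A ⟨0, hi⟩ ∪ B ⟨0, hi⟩ ∪ C ⟨0, hi⟩ := Or.inl (Or.inr hb)
  have hba : b ∈ (closedNbhd G a)ᶜ := by
    rintro (rfl | h)
    · exact hS.2.2.2.2.2.1 _ hbV
    · exact Set.disjoint_left.1 (hS.2.2.1 _) ((hS.2.2.2.2.2.2 _ b hbV).1 h) hb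
  have hbF : b ∉ F := fun h => Set.disjoint_left.1 hdisj h
    (Or.inl (Or.inr (Set.mem_iUnion.2 ⟨_, hbV⟩)))
  have hfa : f ∈ (closedNbhd G a)ᶜ := fun h => Set.disjoint_left.1 hdisj hf (Or.inr h)
  obtain ⟨p, hp⟩ := ha.2 f hfa b hba
  obtain ⟨d, hd, hd₁, hd₂⟩ := p.exists_boundary_dart F hf hbF
  have hya := hp _ (p.dart_snd_mem_support_of_mem_darts hd)
  have hyV : d.snd ∈ PSSVerts a A B C := by
    by_contra hne
    exact hd₂ (hcl _ hd₁ _ (fun h => h.elim hne hya) d.adj)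
  have hatt : d.snd ∈ Att G (PSSVerts a A B C) F := ⟨hyV, _, hd₁, d.adj.symm⟩
  rcases hyV with h | h
  · exact absurd (Or.inl h) hya
  · obtain ⟨t, ht⟩ := Set.mem_iUnion.1 h
    refine ⟨t, _, ?_, hatt⟩
    rcases ht with (ht | ht) | ht
    · exact absurd (Or.inr ((hS.2.2.2.2.2.2 t _ (Or.inl (Or.inl ht))).2 ht)) hya
    · exact Or.inl ht
    · exact Or.inr ht

end StripSystem

theorem statement_15 {V : Type*} [Fintype V] (G : SimpleGraph V)
    (hG : EvenHoleFree G)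
    (a : V) (hsp : Splendid G a) (hnx : ¬ ExtNearPrismCrossEnd G a)
    (k : ℕ) (A B C : Fin k → Set V)
    (hsys : IsPyramidStripSystem G a A B C)
    (hidc : ∀ i, ConnectedSubset G (A i ∪ C i))
    (hmax : ∀ (k' : ℕ) (A' B' C' : Fin k' → Set V),
      IsPyramidStripSystem G a A' B' C' →
      (∀ i, ConnectedSubset G (A' i ∪ C' i)) →
      PSSVerts a A B C ⊆ PSSVerts a A' B' C' →
      PSSVerts a A' B' C' = PSSVerts a A B C)
    (F : Set V) (hF : IsComponentOf G (PSSVerts a A B C ∪ closedNbhd G a) F) :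
    ((Att G (PSSVerts a A B C) F).Nonempty ∧
      Att G (PSSVerts a A B C) F ⊆ ⋃ i, B i) ∨
    (∃ i : Fin k, Att G (PSSVerts a A B C) F ⊆ A i ∪ B i ∪ C i ∧
      (Att G (PSSVerts a A B C) F ∩ (B i ∪ C i)).Nonempty) := by
  have hFa : ∀ m ∈ F, m ≠ a ∧ ¬ G.Adj a m := fun m hm =>
    ⟨fun h => Set.disjoint_left.1 hF.2.1 hm (Or.inr (Or.inl h)),
      fun h => Set.disjoint_left.1 hF.2.1 hm (Or.inr (Or.inr h))⟩
  have hFV : ∀ m ∈ F, ∀ i, m ∉ A i ∪ B i ∪ C i := fun m hm i h =>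
    Set.disjoint_left.1 hF.2.1 hm (Or.inl (Or.inr (Set.mem_iUnion.2 ⟨i, h⟩)))
  have hatt : ∀ v ∈ Att G (PSSVerts a A B C) F, (∃ i, v ∈ A i ∪ B i ∪ C i) ∧
      ∃ x ∈ F, G.Adj v x := by
    rintro v ⟨h | h, x, hx, hvx⟩
    · exact absurd (h ▸ hvx) (hFa x hx).2
    · exact ⟨Set.mem_iUnion.1 h, x, hx, hvx⟩
  obtain ⟨t, y, hy, hyF⟩ := hsys.exists_mem_att hsp.1 hF
  by_cases hB : Att G (PSSVerts a A B C) F ⊆ ⋃ i, B i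
  · exact Or.inl ⟨⟨y, hyF⟩, hB⟩
  right
  obtain ⟨v, hv, hvB⟩ := Set.not_subset.1 hB
  obtain ⟨⟨i, hvi⟩, x, hx, hvx⟩ := hatt v hv
  have hvi' : v ∈ A i ∪ C i := by
    rcases hvi with (h | h) | h
    · exact Or.inl h
    · exact absurd (Set.mem_iUnion.2 ⟨i, h⟩) hvB
    · exact Or.inr h
  have hsub : Att G (PSSVerts a A B C) F ⊆ A i ∪ B i ∪ C i := by
    intro z hz
    obtain ⟨⟨j, hzj⟩, x', hx', hzx⟩ := hatt z hz
    rcases eq_or_ne i j with rfl | hij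
    · exact hzj
    obtain ⟨l, hl, hlx, hlx', hlF⟩ := hF.1.exists_indPath hx hx'
    exact (hsys.not_joins hG hnx hidc hmax hFa hFV hij
      ⟨hl, hlF, hlx, hlx', ⟨v, hvi', hvx.symm⟩, z, hzj, hzx.symm⟩).elim
  refine ⟨i, hsub, y, hyF, ?_⟩
  rcases eq_or_ne t i with rfl | hti
  · exact hy
  · refine (Set.disjoint_left.1 (hsys.2.2.2.1 t i hti) ?_ (hsub hyF)).elim
    exact hy.elim (fun h => Or.inl (Or.inr h)) Or.inr

end EHF
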